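/- arXiv:1606.00804 — 2 statements merged into one kernel-verified Lean document; each statement's English description precedes it below -/
import Mathlib

section
/- Let A = {1,…,k} with k ≥ 3 and let λ = {λ_1,…,λ_l} be a partition of A. Let S be the set of gates consisting of: (1) τ_{a,b} for all 1 ≤ i ≤ l and all a ≠ b ∈ λ_i; (2) τ_{aa,ab} for each 1 ≤ i ≤ l with |λ_i| > 1 and one chosen pair a ≠ b ∈ λ_i; (3) 1-SWAP_{a,b} for each 1 ≤ i < j ≤ l and one chosen pair a ∈ λ_i, b ∈ λ_j. Then ⟨S⟩ = CONS_λ. -/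
/-- A reversible gate function of arity `n` over alphabet `A`: a bijection `A^n → A^n`. -/
abbrev GateFun (A : Type*) (n : ℕ) := (Fin n → A) ≃ (Fin n → A)

/-- A reversible gate over alphabet `A`: an arity together with a bijection of that arity. -/
abbrev Gate (A : Type*) := Σ n : ℕ, GateFun A n

/-- The canonical identification `A^{n+m} ≃ A^n × A^m`. -/
def splitEquiv (A : Type*) (n m : ℕ) :
    (Fin (n + m) → A) ≃ ((Fin n → A) × (Fin m → A)) :=
  (Equiv.arrowCongr finSumFinEquiv.symm (Equiv.refl A)).trans
    (Equiv.sumArrowEquivProdArrow _ _ A)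

/-- The permutation gate `P_σ`, mapping `(a_1,…,a_n)` to `(a_{σ(1)},…,a_{σ(n)})`. -/
def permGate (A : Type*) {n : ℕ} (σ : Equiv.Perm (Fin n)) : GateFun A n :=
  Equiv.arrowCongr σ.symm (Equiv.refl A)

/-- Tensor product of gates. -/
def tensorGate {A : Type*} {n m : ℕ} (F : GateFun A n) (G : GateFun A m) :
    GateFun A (n + m) :=
  ((splitEquiv A n m).trans (F.prodCongr G)).trans (splitEquiv A n m).symm

/-- The generation relation: `Generates S g` means `g` can be generated from the set `S`
of reversible gates using the permutation, tensor product, composition and ancilla rules. -/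
inductive Generates {A : Type*} (S : Set (Gate A)) : Gate A → Prop
  | mem {g : Gate A} : g ∈ S → Generates S g
  | perm (n : ℕ) (σ : Equiv.Perm (Fin n)) : Generates S ⟨n, permGate A σ⟩
  | tensor {n m : ℕ} {F : GateFun A n} {G : GateFun A m} :
      Generates S ⟨n, F⟩ → Generates S ⟨m, G⟩ → Generates S ⟨n + m, tensorGate F G⟩
  | comp {n : ℕ} {F G : GateFun A n} :
      Generates S ⟨n, F⟩ → Generates S ⟨n, G⟩ → Generates S ⟨n, G.trans F⟩
  | ancilla {l m : ℕ} {F : GateFun A (l + m)} (a : Fin l → A) {F' : GateFun A m} :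
      Generates S ⟨l + m, F⟩ →
      (∀ b : Fin m → A,
        F ((splitEquiv A l m).symm (a, b)) = (splitEquiv A l m).symm (a, F' b)) →
      Generates S ⟨m, F'⟩

/-- The gate class `⟨S⟩` generated by a set `S` of reversible gates. -/
def genClosure {A : Type*} (S : Set (Gate A)) : Set (Gate A) := {g | Generates S g}

/-- A reversible gate class: a set of gates closed under the generation rules. -/
def IsGateClass {A : Type*} (S : Set (Gate A)) : Prop := ∀ g, Generates S g → g ∈ S

/-- The transposition gate `τ_{u,v}` exchanging the inputs `u` and `v`. -/
def tau {A : Type*} [DecidableEq A] {n : ℕ} (u v : Fin n → A) : GateFun A n :=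
  Equiv.swap u v

/-- The controlled gate `w-F`, mapping `w u` to `w F(u)` and fixing all other inputs. -/
def controlled {A : Type*} [DecidableEq A] {l n : ℕ} (w : Fin l → A) (F : GateFun A n) :
    GateFun A (l + n) :=
  ((splitEquiv A l n).trans
    (Equiv.prodCongrRight fun p => if p = w then F else Equiv.refl _)).trans
    (splitEquiv A l n).symm

/-- `SWAP_{a,b}` for single symbols `a`, `b`: exchanges `ab` and `ba`. -/
def swapGate {A : Type*} [DecidableEq A] (a b : A) : GateFun A 2 :=
  tau ![a, b] ![b, a]

/-- Number of occurrences of the symbol `a` in the string `x`. -/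
def countOf {A : Type*} [DecidableEq A] {n : ℕ} (a : A) (x : Fin n → A) : ℕ :=
  (Finset.univ.filter fun i => x i = a).card

/-- Number of positions of the string `x` whose symbol lies in the set `s`. -/
def countIn {A : Type*} [DecidableEq A] {n : ℕ} (s : Finset A) (x : Fin n → A) : ℕ :=
  (Finset.univ.filter fun i => x i ∈ s).card

section Realization

variable {A : Type*} {S : Set (Gate A)} {ι κ : Type*}

/-- `f` is computed by a gate generated from `S`, for some labelling of the wires `ι`. -/
def Realizes (S : Set (Gate A)) {ι : Type*} (f : (ι → A) → ι → A) : Prop :=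
  ∃ (n : ℕ) (e : ι ≃ Fin n) (F : GateFun A n),
    Generates S ⟨n, F⟩ ∧ ∀ x : Fin n → A, f (x ∘ e) = F x ∘ e

theorem permGate_apply {n : ℕ} (σ : Equiv.Perm (Fin n)) (x : Fin n → A) :
    permGate A σ x = x ∘ σ := rfl

theorem splitEquiv_symm_comp_finSumFinEquiv {n m : ℕ} (a : Fin n → A) (b : Fin m → A) :
    (splitEquiv A n m).symm (a, b) ∘ finSumFinEquiv = Sum.elim a b := by
  ext i
  cases i <;> simp [splitEquiv, Equiv.sumArrowEquivProdArrow, Equiv.arrowCongr]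

theorem splitEquiv_symm_eq {n m : ℕ} (a : Fin n → A) (b : Fin m → A) :
    (splitEquiv A n m).symm (a, b) = Sum.elim a b ∘ finSumFinEquiv.symm := by
  rw [← splitEquiv_symm_comp_finSumFinEquiv, Function.comp_assoc]
  simp

theorem tensorGate_splitEquiv_symm {n m : ℕ} (F : GateFun A n) (G : GateFun A m)
    (a : Fin n → A) (b : Fin m → A) :
    tensorGate F G ((splitEquiv A n m).symm (a, b)) = (splitEquiv A n m).symm (F a, G b) := by
  simp [tensorGate]

theorem Realizes.exists_gate {f : (ι → A) → ι → A} (hf : Realizes S f) {m : ℕ}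
    (e : ι ≃ Fin m) :
    ∃ F : GateFun A m, Generates S ⟨m, F⟩ ∧ ∀ x : Fin m → A, f (x ∘ e) = F x ∘ e := by
  obtain ⟨n, e₀, F, hF, hfF⟩ := hf
  obtain rfl : n = m := by simpa using Fintype.card_congr (e₀.symm.trans e)
  refine ⟨((permGate A (e₀.symm.trans e)).trans F).trans (permGate A (e.symm.trans e₀)),
    .comp (.perm _ _) (.comp hF (.perm _ _)), fun x => ?_⟩
  have h := hfF (x ∘ (e₀.symm.trans e))
  have h' : (x ∘ (e₀.symm.trans e)) ∘ e₀ = x ∘ e := by ext; simp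
  rw [h'] at h
  rw [h]
  ext
  simp [permGate_apply]

theorem Realizes.comp {f g : (ι → A) → ι → A} (hf : Realizes S f) (hg : Realizes S g) :
    Realizes S (f ∘ g) := by
  obtain ⟨n, e, G, hG, hgG⟩ := hg
  obtain ⟨F, hF, hfF⟩ := hf.exists_gate e
  exact ⟨n, e, G.trans F, .comp hF hG, fun x => by simp [hgG, hfF]⟩

theorem Realizes.id [Finite ι] : Realizes S (id : (ι → A) → ι → A) := by
  obtain ⟨n, ⟨e⟩⟩ := Finite.exists_equiv_fin ι
  exact ⟨n, e, permGate A 1, .perm _ _, fun x => rfl⟩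

/-- The permutations of the states of the wires `ι` that are realized by gates. -/
def realizedPerms (S : Set (Gate A)) (ι : Type*) [Finite ι] :
    Submonoid (Equiv.Perm (ι → A)) where
  carrier := {σ | Realizes S σ}
  one_mem' := Realizes.id
  mul_mem' := fun hf hg => hf.comp hg

theorem mem_realizedPerms [Finite ι] {σ : Equiv.Perm (ι → A)} :
    σ ∈ realizedPerms S ι ↔ Realizes S σ := Iff.rfl

theorem Realizes.of_generates [Finite ι] {m : ℕ} {F : GateFun A m} (hF : Generates S ⟨m, F⟩)
    {φ : Fin m → ι} (hφ : Function.Injective φ) {f : (ι → A) → ι → A}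
    (hf : ∀ x, f x ∘ φ = F (x ∘ φ)) (hf' : ∀ x i, (∀ t, φ t ≠ i) → f x i = x i) :
    Realizes S f := by
  classical
  obtain ⟨r, ⟨e⟩⟩ := Finite.exists_equiv_fin ↥(Set.range φ)ᶜ
  let E : ι ≃ Fin (m + r) := (Equiv.Set.sumCompl (Set.range φ)).symm.trans
    ((Equiv.sumCongr (Equiv.ofInjective φ hφ).symm e).trans finSumFinEquiv)
  have hE : ∀ t, E (φ t) = finSumFinEquiv (Sum.inl t) := fun t => by
    simp [E, Equiv.Set.sumCompl_symm_apply_of_mem]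
  have hE' : ∀ i, (∀ t, φ t ≠ i) → ∃ s, E i = finSumFinEquiv (Sum.inr s) := fun i hi => by
    have : i ∉ Set.range φ := by simpa using hi
    exact ⟨e ⟨i, this⟩, by simp [E, Equiv.Set.sumCompl_symm_apply_of_notMem this]⟩
  refine ⟨m + r, E, tensorGate F (permGate A 1), .tensor hF (.perm _ _), fun x => ?_⟩
  obtain ⟨⟨a, b⟩, rfl⟩ := (splitEquiv A m r).symm.surjective x
  have hab : ((splitEquiv A m r).symm (a, b) ∘ E) ∘ φ = a := by
    ext t
    simp [hE, splitEquiv_symm_eq]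
  ext i
  by_cases hi : ∃ t, φ t = i
  · obtain ⟨t, rfl⟩ := hi
    have := congrFun (hf ((splitEquiv A m r).symm (a, b) ∘ E)) t
    rw [hab] at this
    rw [Function.comp_apply] at this
    rw [this, Function.comp_apply, tensorGate_splitEquiv_symm]
    simp [hE, splitEquiv_symm_eq]
  · push Not at hi
    rw [hf' _ _ hi]
    obtain ⟨s, hs⟩ := hE' i hi
    rw [Function.comp_apply, Function.comp_apply, tensorGate_splitEquiv_symm]
    simp [hs, splitEquiv_symm_eq, permGate_apply]

theorem Realizes.of_ancilla [Finite ι] [Finite κ] [Finite A]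
    {h : (κ ⊕ ι → A) → κ ⊕ ι → A} (hh : Realizes S h) (α : κ → A) {f : (ι → A) → ι → A}
    (hf : ∀ x, h (Sum.elim α x) = Sum.elim α (f x)) : Realizes S f := by
  obtain ⟨l, ⟨e₁⟩⟩ := Finite.exists_equiv_fin κ
  obtain ⟨m, ⟨e₂⟩⟩ := Finite.exists_equiv_fin ι
  let E : κ ⊕ ι ≃ Fin (l + m) := (Equiv.sumCongr e₁ e₂).trans finSumFinEquiv
  obtain ⟨H, hH, hhH⟩ := hh.exists_gate E
  have key : ∀ b : Fin m → A, H ((splitEquiv A l m).symm (α ∘ e₁.symm, b)) =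
      (splitEquiv A l m).symm (α ∘ e₁.symm, f (b ∘ e₂) ∘ e₂.symm) := fun b => by
    have h₁ : (splitEquiv A l m).symm (α ∘ e₁.symm, b) ∘ E = Sum.elim α (b ∘ e₂) := by
      ext i
      cases i <;> simp [E, splitEquiv_symm_eq]
    have h₂ : (splitEquiv A l m).symm (α ∘ e₁.symm, f (b ∘ e₂) ∘ e₂.symm) ∘ E =
        Sum.elim α (f (b ∘ e₂)) := by
      ext i
      cases i <;> simp [E, splitEquiv_symm_eq]
    have h₃ := hhH ((splitEquiv A l m).symm (α ∘ e₁.symm, b))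
    rw [h₁, hf, ← h₂] at h₃
    exact (E.surjective.injective_comp_right h₃).symm
  have inj : Function.Injective fun b : Fin m → A => f (b ∘ e₂) ∘ e₂.symm := fun b b' hb => by
    have := (key b).trans ((congrArg (fun c => (splitEquiv A l m).symm (α ∘ e₁.symm, c)) hb).trans
      (key b').symm)
    simpa using this
  refine ⟨m, e₂, Equiv.ofBijective _ (Finite.injective_iff_bijective.mp inj),
    .ancilla (α ∘ e₁.symm) hH key, fun x => ?_⟩
  ext
  simp

theorem Realizes.injective {f : (ι → A) → ι → A} (hf : Realizes S f) :
    Function.Injective f := by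
  obtain ⟨n, e, F, -, hfF⟩ := hf
  intro x y hxy
  have h := hfF (x ∘ e.symm)
  have h' := hfF (y ∘ e.symm)
  simp only [Function.comp_assoc, Equiv.symm_comp_self, Function.comp_id] at h h'
  rw [h, h'] at hxy
  exact e.symm.surjective.injective_comp_right (F.injective (e.surjective.injective_comp_right hxy))

/-- Conjugating a realized map by another one, with borrowed wires in the state `α`. -/
theorem Realizes.of_conj_ancilla [Finite ι] [Finite κ] [Finite A]
    {u v : (κ ⊕ ι → A) → κ ⊕ ι → A} (hu : Realizes S u) (hv : Realizes S v) (α : κ → A)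
    {f : (ι → A) → ι → A} (hf : ∀ x, v (u (Sum.elim α x)) = u (Sum.elim α (f x))) :
    Realizes S f := by
  let σ : Equiv.Perm (κ ⊕ ι → A) :=
    Equiv.ofBijective u (Finite.injective_iff_bijective.mp hu.injective)
  have hσ : σ ∈ realizedPerms S (κ ⊕ ι) := hu
  have hσ' : Realizes S ⇑σ⁻¹ := by
    rw [← mem_realizedPerms, ← eq_inv_of_mul_eq_one_left
      ((pow_sub_one_mul (orderOf_pos σ).ne' σ).trans (pow_orderOf_eq_one σ))]
    exact pow_mem hσ _
  refine Realizes.of_ancilla (hσ'.comp (hv.comp hu)) α fun x => ?_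
  simp only [Function.comp_apply, hf]
  exact σ.symm_apply_apply _

end Realization

section Controls

variable {A : Type*} {ι κ : Type*}

/-- The state `x` carries on each wire of the list `L` the symbol prescribed by `L`. -/
def Controls (L : List (ι × A)) (x : ι → A) : Prop := ∀ p ∈ L, x p.1 = p.2

instance [DecidableEq A] (L : List (ι × A)) (x : ι → A) : Decidable (Controls L x) :=
  inferInstanceAs (Decidable (∀ p ∈ L, x p.1 = p.2))

/-- Transfer of a list of controls to a larger set of wires. -/
def liftControls (κ : Type*) (L : List (ι × A)) : List ((κ ⊕ ι) × A) :=
  L.map (Prod.map Sum.inr id)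

@[simp]
theorem controls_nil (x : ι → A) : Controls [] x := by simp [Controls]

@[simp]
theorem controls_cons (p : ι × A) (L : List (ι × A)) (x : ι → A) :
    Controls (p :: L) x ↔ x p.1 = p.2 ∧ Controls L x := by simp [Controls]

@[simp]
theorem controls_liftControls (L : List (ι × A)) (α : κ → A) (x : ι → A) :
    Controls (liftControls κ L) (Sum.elim α x) ↔ Controls L x := by
  simp only [Controls, liftControls, List.forall_mem_map]
  rfl

theorem controls_congr {L : List (ι × A)} {x y : ι → A} (h : ∀ p ∈ L, x p.1 = y p.1) :
    Controls L x ↔ Controls L y :=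
  forall₂_congr fun p hp => by rw [h p hp]

theorem liftControls_ne_inl {L : List (ι × A)} (k : κ) :
    ∀ p ∈ liftControls κ L, p.1 ≠ Sum.inl k := by
  simp [liftControls]

variable [DecidableEq A] [DecidableEq ι] [DecidableEq κ]

/-- If the controls `L` hold, exchange the symbols `a` and `b` on the wire `j`. -/
def ctrlTau (L : List (ι × A)) (j : ι) (a b : A) (x : ι → A) : ι → A :=
  if Controls L x then Function.update x j (Equiv.swap a b (x j)) else x

/-- Exchange the contents of the wires `i`, `j` if they are `a`, `b` in some order. -/
def swapCells (i j : ι) (a b : A) (x : ι → A) : ι → A :=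
  if (x i = a ∧ x j = b) ∨ (x i = b ∧ x j = a) then x ∘ Equiv.swap i j else x

/-- If the controls `L` hold, apply `swapCells i j a b`. -/
def ctrlSwap (L : List (ι × A)) (i j : ι) (a b : A) (x : ι → A) : ι → A :=
  if Controls L x then swapCells i j a b x else x

theorem swapCells_apply_of_ne {i j k : ι} (hi : k ≠ i) (hj : k ≠ j) (a b : A) (x : ι → A) :
    swapCells i j a b x k = x k := by
  unfold swapCells
  split_ifs <;> simp [Equiv.swap_apply_of_ne_of_ne hi hj]

theorem swapCells_symbols_comm (i j : ι) (a b : A) : swapCells i j a b = swapCells i j b a := by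
  ext x
  simp only [swapCells, or_comm]

theorem swapCells_swapCells (i j : ι) (a b : A) (x : ι → A) :
    swapCells i j a b (swapCells i j a b x) = x := by
  by_cases h : (x i = a ∧ x j = b) ∨ (x i = b ∧ x j = a)
  · have h' : (x j = a ∧ x i = b) ∨ (x j = b ∧ x i = a) := by tauto
    ext k
    simp [swapCells, h, h']
  · simp [swapCells, h]

theorem ctrlSwap_symbols_comm (L : List (ι × A)) (i j : ι) (a b : A) :
    ctrlSwap L i j a b = ctrlSwap L i j b a := by
  ext x
  simp only [ctrlSwap, swapCells_symbols_comm i j a b]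

theorem ctrlTau_self (L : List (ι × A)) (j : ι) (a : A) : ctrlTau L j a a = id := by
  ext x
  simp [ctrlTau]

theorem swapCells_inr (i j : ι) (a b : A) (α : κ → A) (x : ι → A) :
    swapCells (.inr i) (.inr j) a b (Sum.elim α x) = Sum.elim α (swapCells i j a b x) := by
  by_cases h : (x i = a ∧ x j = b) ∨ (x i = b ∧ x j = a)
  · ext (k | k)
    · rw [swapCells_apply_of_ne (by simp) (by simp)]
      rfl
    · rw [swapCells, swapCells, if_pos (by simpa using h), if_pos h]
      simp only [Function.comp_apply, Equiv.swap_apply_def, Sum.inr.injEq, Sum.elim_inr]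
      split_ifs <;> rfl
  · simp [swapCells, h]

theorem swapCells_inl (i j : κ) (a b : A) (α : κ → A) (x : ι → A) :
    swapCells (.inl i) (.inl j) a b (Sum.elim α x) = Sum.elim (swapCells i j a b α) x := by
  by_cases h : (α i = a ∧ α j = b) ∨ (α i = b ∧ α j = a)
  · ext (k | k)
    · rw [swapCells, swapCells, if_pos (by simpa using h), if_pos h]
      simp only [Function.comp_apply, Equiv.swap_apply_def, Sum.inl.injEq, Sum.elim_inl]
      split_ifs <;> rfl
    · rw [swapCells_apply_of_ne (by simp) (by simp)]
      rfl
  · simp [swapCells, h]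

theorem ctrlTau_lift_inl (L : List (ι × A)) (k : κ) (a b : A) (α : κ → A) (x : ι → A) :
    ctrlTau (liftControls κ L) (.inl k) a b (Sum.elim α x) =
      Sum.elim (if Controls L x then Function.update α k (Equiv.swap a b (α k)) else α) x := by
  unfold ctrlTau
  simp only [controls_liftControls, Sum.update_elim_inl, Sum.elim_inl]
  split_ifs <;> rfl

theorem ctrlTau_inr (k : κ) (c : A) (j : ι) (a b : A) (α : κ → A) (x : ι → A) :
    ctrlTau [(.inl k, c)] (.inr j) a b (Sum.elim α x) =
      Sum.elim α (if α k = c then Function.update x j (Equiv.swap a b (x j)) else x) := by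
  unfold ctrlTau
  simp only [controls_cons, controls_nil, and_true, Sum.elim_inl, Sum.update_elim_inr,
    Sum.elim_inr]
  split_ifs <;> rfl

theorem ctrlSwap_lift_inl (L : List (ι × A)) (i j : κ) (a b : A) (α : κ → A) (x : ι → A) :
    ctrlSwap (liftControls κ L) (.inl i) (.inl j) a b (Sum.elim α x) =
      Sum.elim (if Controls L x then swapCells i j a b α else α) x := by
  unfold ctrlSwap
  simp only [controls_liftControls, swapCells_inl]
  split_ifs <;> rfl

theorem ctrlSwap_inr (k : κ) (c : A) (i j : ι) (a b : A) (α : κ → A) (x : ι → A) :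
    ctrlSwap [(.inl k, c)] (.inr i) (.inr j) a b (Sum.elim α x) =
      Sum.elim α (if α k = c then swapCells i j a b x else x) := by
  unfold ctrlSwap
  simp only [controls_cons, controls_nil, and_true, Sum.elim_inl, swapCells_inr]
  split_ifs <;> rfl

theorem controls_ctrlTau {L M : List (ι × A)} {j : ι} (hL : ∀ p ∈ L, p.1 ≠ j) (a b : A)
    (x : ι → A) : Controls L (ctrlTau M j a b x) ↔ Controls L x := by
  refine controls_congr fun p hp => ?_
  unfold ctrlTau
  split_ifs
  · exact Function.update_of_ne (hL p hp) _ _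
  · rfl

theorem controls_ctrlSwap {L M : List (ι × A)} {i j : ι} (hi : ∀ p ∈ L, p.1 ≠ i)
    (hj : ∀ p ∈ L, p.1 ≠ j) (a b : A) (x : ι → A) :
    Controls L (ctrlSwap M i j a b x) ↔ Controls L x := by
  refine controls_congr fun p hp => ?_
  unfold ctrlSwap
  split_ifs
  · exact swapCells_apply_of_ne (hi p hp) (hj p hp) a b x
  · rfl

end Controls

section Universality

variable {A : Type*} [DecidableEq A] [Finite A] {S : Set (Gate A)}

/-- With three symbols that can be permuted under single controls, one borrowed wire suffices to
conjoin controls. -/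
theorem realizes_ctrlTau_of_three {a₀ b₀ c₀ : A} (hab : a₀ ≠ b₀) (hac : a₀ ≠ c₀)
    (hbc : b₀ ≠ c₀)
    (h₀ : ∀ {ι : Type} [Finite ι] [DecidableEq ι] (j : ι) (a b : A),
      Realizes S (ctrlTau [] j a b))
    (h₁ : ∀ {ι : Type} [Finite ι] [DecidableEq ι] (i j : ι) (c a b : A), i ≠ j →
      Realizes S (ctrlTau [(i, c)] j a b))
    {ι : Type} [Finite ι] [DecidableEq ι] (L : List (ι × A)) (j : ι) (a b : A)
    (hL : ∀ p ∈ L, p.1 ≠ j) : Realizes S (ctrlTau L j a b) := by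
  suffices H : ∀ (n : ℕ) {ι : Type} [Finite ι] [DecidableEq ι] (L : List (ι × A)) (j : ι)
      (a b : A), (∀ p ∈ L, p.1 ≠ j) → L.length = n → Realizes S (ctrlTau L j a b) from
    H _ L j a b hL rfl
  intro n
  induction n with
  | zero =>
    intro ι _ _ L j a b _ hn
    rw [List.length_eq_zero_iff.mp hn]
    exact h₀ j a b
  | succ n ih =>
    rintro ι _ _ (_ | ⟨⟨i, c⟩, L⟩) j a b hL hn
    · simp at hn
    have hi : ∀ p ∈ [(i, c)], p.1 ≠ j := by simpa using hL (i, c) (by simp)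
    have hL' : ∀ p ∈ L, p.1 ≠ j := fun p hp => hL p (by simp [hp])
    have hu₁ := ih (liftControls Unit L) (.inl ()) a₀ b₀ (liftControls_ne_inl ())
      (by simpa [liftControls] using hn)
    have hu₂ : Realizes S (ctrlTau (liftControls Unit [(i, c)]) (.inl ()) b₀ c₀) :=
      h₁ _ _ _ _ _ (by simp)
    have hv : Realizes S (ctrlTau [((.inl () : Unit ⊕ ι), c₀)] (.inr j) a b) :=
      h₁ _ _ _ _ _ (by simp)
    refine (hu₂.comp hu₁).of_conj_ancilla hv (fun _ => a₀) fun x => ?_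
    simp only [Function.comp_apply, ctrlTau_lift_inl, ctrlTau_inr, controls_ctrlTau hi,
      controls_ctrlTau hL']
    congr 1
    by_cases h : Controls L x <;> by_cases h' : x i = c <;>
      simp [h, h', ctrlTau, hac, hbc, hab, Equiv.swap_apply_of_ne_of_ne]

variable {β : Type*} (blk : A → β)

/-- Three borrowed wires suffice to conjoin controls of exchanges. -/
theorem realizes_ctrlSwap_of_single {a₀ b₀ : A} (hab : blk a₀ ≠ blk b₀)
    (h₀ : ∀ {ι : Type} [Finite ι] [DecidableEq ι] (i j : ι) (a b : A), i ≠ j →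
      blk a ≠ blk b → Realizes S (ctrlSwap [] i j a b))
    (h₁ : ∀ {ι : Type} [Finite ι] [DecidableEq ι] (k i j : ι) (c a b : A), k ≠ i → k ≠ j →
      i ≠ j → blk a ≠ blk b → Realizes S (ctrlSwap [(k, c)] i j a b))
    {ι : Type} [Finite ι] [DecidableEq ι] (L : List (ι × A)) (i j : ι) (a b : A) (hij : i ≠ j)
    (hLi : ∀ p ∈ L, p.1 ≠ i) (hLj : ∀ p ∈ L, p.1 ≠ j) (hne : blk a ≠ blk b) :
    Realizes S (ctrlSwap L i j a b) := by
  suffices H : ∀ (n : ℕ) {ι : Type} [Finite ι] [DecidableEq ι] (L : List (ι × A)) (i j : ι)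
      (a b : A), i ≠ j → (∀ p ∈ L, p.1 ≠ i) → (∀ p ∈ L, p.1 ≠ j) → blk a ≠ blk b →
      L.length = n → Realizes S (ctrlSwap L i j a b) from
    H _ L i j a b hij hLi hLj hne rfl
  have hab' : a₀ ≠ b₀ := fun h => hab (congrArg blk h)
  intro n
  induction n with
  | zero =>
    intro ι _ _ L i j a b hij _ _ hne hn
    rw [List.length_eq_zero_iff.mp hn]
    exact h₀ i j a b hij hne
  | succ n ih =>
    rintro ι _ _ (_ | ⟨⟨k, c⟩, L⟩) i j a b hij hLi hLj hne hn
    · simp at hn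
    have hki : ∀ p ∈ [(k, c)], p.1 ≠ i := by simpa using hLi (k, c) (by simp)
    have hkj : ∀ p ∈ [(k, c)], p.1 ≠ j := by simpa using hLj (k, c) (by simp)
    have hLi' : ∀ p ∈ L, p.1 ≠ i := fun p hp => hLi p (by simp [hp])
    have hLj' : ∀ p ∈ L, p.1 ≠ j := fun p hp => hLj p (by simp [hp])
    have hu₁ : Realizes S (ctrlSwap (liftControls (Fin 3) [(k, c)]) (.inl 0) (.inl 1) a₀ b₀) :=
      h₁ _ _ _ _ _ _ (by simp) (by simp) (by simp) hab
    have hu₂ := ih (liftControls (Fin 3) L) (.inl 1) (.inl 2) a₀ b₀ (by simp)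
      (liftControls_ne_inl 1) (liftControls_ne_inl 2) hab (by simpa [liftControls] using hn)
    have hv : Realizes S (ctrlSwap [((.inl 2 : Fin 3 ⊕ ι), b₀)] (.inr i) (.inr j) a b) :=
      h₁ _ _ _ _ _ _ (by simp) (by simp) (by simpa using hij) hne
    refine (hu₂.comp hu₁).of_conj_ancilla hv ![b₀, a₀, a₀] fun x => ?_
    simp only [Function.comp_apply, ctrlSwap_lift_inl, ctrlSwap_inr, controls_ctrlSwap hki hkj,
      controls_ctrlSwap hLi' hLj']
    congr 1
    by_cases h : Controls L x <;> by_cases h' : x k = c <;>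
      simp [h, h', ctrlSwap, swapCells, hab', hab'.symm, Equiv.swap_apply_def]

/-- An unconditional exchange and one controlled by a fixed symbol `o` give exchanges controlled
by any symbol. -/
theorem realizes_ctrlSwap_single (o : A)
    (hT : ∀ {ι : Type} [Finite ι] [DecidableEq ι] (j : ι) (a b : A), blk a = blk b →
      Realizes S (ctrlTau [] j a b))
    (h₀ : ∀ {ι : Type} [Finite ι] [DecidableEq ι] (i j : ι) (a b : A), i ≠ j →
      blk a ≠ blk b → Realizes S (ctrlSwap [] i j a b))
    (h₁ : ∀ {ι : Type} [Finite ι] [DecidableEq ι] (k i j : ι) (a b : A), k ≠ i → k ≠ j →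
      i ≠ j → blk a ≠ blk b → Realizes S (ctrlSwap [(k, o)] i j a b))
    {ι : Type} [Finite ι] [DecidableEq ι] (k i j : ι) (c a b : A) (hki : k ≠ i) (hkj : k ≠ j)
    (hij : i ≠ j) (hne : blk a ≠ blk b) : Realizes S (ctrlSwap [(k, c)] i j a b) := by
  have hc : ∀ v, ∀ x : ι → A, swapCells i j a b (Function.update x k v) =
      Function.update (swapCells i j a b x) k v := fun v x => by
    ext m
    by_cases hm : m = k
    · subst hm
      rw [swapCells_apply_of_ne hki hkj]
      simp
    · simp only [swapCells, Function.update_of_ne hki.symm, Function.update_of_ne hkj.symm,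
        Function.update_of_ne hm]
      split_ifs
      · simp only [Function.comp_apply]
        rw [Function.update_of_ne]
        simpa [Equiv.swap_apply_eq_iff, Equiv.swap_apply_of_ne_of_ne hki hkj] using hm
      · exact Function.update_of_ne hm _ _
  by_cases hco : blk c = blk o
  · have hu := hT k c o hco
    convert hu.comp ((h₁ k i j a b hki hkj hij hne).comp hu) using 1
    ext x : 1
    by_cases h : x k = c
    · simp [ctrlTau, ctrlSwap, h, hc, swapCells_apply_of_ne hki hkj]
    · have : Equiv.swap c o (x k) ≠ o := by simpa [Equiv.swap_apply_eq_iff] using h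
      simp [ctrlTau, ctrlSwap, h, this]
  · have hco' : c ≠ o := fun h => hco (congrArg blk h)
    have hu : Realizes S (ctrlSwap [] (.inr k) (.inl () : Unit ⊕ ι) c o) :=
      h₀ _ _ _ _ (by simp) hco
    have hv₁ : Realizes S (ctrlSwap [] (.inr i) (.inr j : Unit ⊕ ι) a b) :=
      h₀ _ _ _ _ (by simpa using hij) hne
    have hv₂ : Realizes S (ctrlSwap [((.inl () : Unit ⊕ ι), o)] (.inr i) (.inr j) a b) :=
      h₁ _ _ _ _ _ (by simp) (by simp) (by simpa using hij) hne
    have hux : ∀ x : ι → A, ctrlSwap [] (.inr k) (.inl () : Unit ⊕ ι) c o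
        (Sum.elim (fun _ => o) x) = Sum.elim (fun _ => if x k = c then c else o)
          (if x k = c then Function.update x k o else x) := fun x => by
      by_cases h : x k = c
      · ext (m | m)
        · simp [ctrlSwap, swapCells, h]
        · by_cases hm : m = k
          · subst hm
            simp [ctrlSwap, swapCells, h]
          · rw [ctrlSwap, if_pos (controls_nil _), swapCells_apply_of_ne (by simpa using hm) (by simp)]
            simp [h, hm]
      · simp [ctrlSwap, swapCells, h, hco'.symm]
    refine hu.of_conj_ancilla (hv₁.comp hv₂) (fun _ => o) fun x => ?_
    rw [hux, hux]
    simp only [Function.comp_apply, ctrlSwap_inr]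
    by_cases h : x k = c
    · simp [ctrlSwap, h, hco', swapCells_inr, hc, swapCells_apply_of_ne hki hkj,
        -Sum.elim_update_right]
    · simp [ctrlSwap, h, swapCells_inr, swapCells_swapCells]

/-- Controlled exchanges transfer their controls to changes of a single symbol. -/
theorem realizes_ctrlTau_of_ctrlSwap
    (hS : ∀ {ι : Type} [Finite ι] [DecidableEq ι] (L : List (ι × A)) (i j : ι) (a b : A),
      i ≠ j → (∀ p ∈ L, p.1 ≠ i) → (∀ p ∈ L, p.1 ≠ j) → blk a ≠ blk b →
      Realizes S (ctrlSwap L i j a b))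
    (h₁ : ∀ {ι : Type} [Finite ι] [DecidableEq ι] (i j : ι) (c a b : A), i ≠ j →
      blk c = blk a → blk c = blk b → Realizes S (ctrlTau [(i, c)] j a b))
    {ι : Type} [Finite ι] [DecidableEq ι] (L : List (ι × A)) (j : ι) (a b c : A)
    (hL : ∀ p ∈ L, p.1 ≠ j) (hab : blk a = blk b) (hac : blk a ≠ blk c) :
    Realizes S (ctrlTau L j a b) := by
  have hac' : a ≠ c := fun h => hac (congrArg blk h)
  have hu := hS (liftControls (Fin 2) L) (.inl 0) (.inl 1) a c (by simp)
    (liftControls_ne_inl 0) (liftControls_ne_inl 1) hac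
  have hv : Realizes S (ctrlTau [((.inl 1 : Fin 2 ⊕ ι), a)] (.inr j) a b) :=
    h₁ _ _ _ _ _ (by simp) rfl hab
  refine hu.of_conj_ancilla hv ![a, c] fun x => ?_
  simp only [ctrlSwap_lift_inl, ctrlTau_inr, controls_ctrlTau hL]
  congr 1
  by_cases h : Controls L x <;> simp [h, ctrlTau, swapCells, hac'.symm]

end Universality

section Blocks

variable {A : Type*} [DecidableEq A] {S : Set (Gate A)} {β : Type*} {blk : A → β}

/-- Controlled gates with arbitrarily many controls, from those with at most one control. -/
theorem realizes_controlled [Finite A] {a₀ b₀ c₀ : A} (hab : a₀ ≠ b₀) (hac : a₀ ≠ c₀) (hbc : b₀ ≠ c₀)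
    (o : A)
    (hT : ∀ {ι : Type} [Finite ι] [DecidableEq ι] (j : ι) (a b : A), blk a = blk b →
      Realizes S (ctrlTau [] j a b))
    (hC : ∀ {ι : Type} [Finite ι] [DecidableEq ι] (i j : ι) (c a b : A), i ≠ j →
      blk c = blk a → blk c = blk b → Realizes S (ctrlTau [(i, c)] j a b))
    (hF : ∀ {ι : Type} [Finite ι] [DecidableEq ι] (k i j : ι) (a b : A), k ≠ i → k ≠ j →
      i ≠ j → blk a ≠ blk b → Realizes S (ctrlSwap [(k, o)] i j a b))
    {ι : Type} [Finite ι] [DecidableEq ι] (L : List (ι × A)) :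
    (∀ j a b, (∀ p ∈ L, p.1 ≠ j) → blk a = blk b → Realizes S (ctrlTau L j a b)) ∧
    ∀ i j a b, i ≠ j → (∀ p ∈ L, p.1 ≠ i) → (∀ p ∈ L, p.1 ≠ j) → blk a ≠ blk b →
      Realizes S (ctrlSwap L i j a b) := by
  by_cases hblk : ∃ a b : A, blk a ≠ blk b
  · obtain ⟨a₁, b₁, h₁⟩ := hblk
    have hF₀ : ∀ {ι : Type} [Finite ι] [DecidableEq ι] (i j : ι) (a b : A), i ≠ j →
        blk a ≠ blk b → Realizes S (ctrlSwap [] i j a b) := by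
      intro ι _ _ i j a b hij h
      refine (hF (.inl ()) (.inr i) (.inr j : Unit ⊕ ι) a b (by simp) (by simp)
        (by simpa using hij) h).of_ancilla (fun _ => o) fun x => ?_
      rw [ctrlSwap_inr]
      simp [ctrlSwap]
    have hS : ∀ {ι : Type} [Finite ι] [DecidableEq ι] (L : List (ι × A)) (i j : ι) (a b : A),
        i ≠ j → (∀ p ∈ L, p.1 ≠ i) → (∀ p ∈ L, p.1 ≠ j) → blk a ≠ blk b →
        Realizes S (ctrlSwap L i j a b) :=
      realizes_ctrlSwap_of_single blk h₁ hF₀ (realizes_ctrlSwap_single blk o hT hF₀ hF)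
    refine ⟨fun j a b hL h => ?_, hS L⟩
    obtain ⟨c, hc⟩ : ∃ c, blk a ≠ blk c := by
      by_contra! hc
      exact h₁ ((hc a₁).symm.trans (hc b₁))
    exact realizes_ctrlTau_of_ctrlSwap blk hS hC L j a b c hL h hc
  · push Not at hblk
    exact ⟨fun j a b hL _ => realizes_ctrlTau_of_three hab hac hbc
      (fun j a b => hT j a b (hblk a b)) (fun i j c a b hij => hC i j c a b hij (hblk _ _)
      (hblk _ _)) L j a b hL, fun i j a b _ _ _ h => absurd (hblk a b) h⟩

variable {ι : Type*} [DecidableEq ι]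

theorem Realizes.ctrlTau_control {i j : ι} (hij : i ≠ j) {c c' a b : A}
    (h : Realizes S (ctrlTau [(i, c)] j a b)) (hc : Realizes S (ctrlTau [] i c c')) :
    Realizes S (ctrlTau [(i, c')] j a b) := by
  convert hc.comp (h.comp hc) using 1
  ext x : 1
  have hiff : Equiv.swap c c' (x i) = c ↔ x i = c' := by simp [Equiv.swap_apply_eq_iff]
  by_cases hx : x i = c'
  · subst hx
    simp [ctrlTau, hij, hij.symm, Function.update_comm hij.symm]
  · simp [ctrlTau, hx, hiff]

theorem Realizes.ctrlTau_symbols {L : List (ι × A)} {j : ι} (hL : ∀ p ∈ L, p.1 ≠ j)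
    {a b d e : A} (h : Realizes S (ctrlTau L j a b)) (hd : Realizes S (ctrlTau [] j d e)) :
    Realizes S (ctrlTau L j (Equiv.swap d e a) (Equiv.swap d e b)) := by
  convert hd.comp (h.comp hd) using 1
  ext x : 1
  have hiff := controls_ctrlTau (M := []) hL d e x
  by_cases hx : Controls L x
  · rw [Function.comp_apply, Function.comp_apply, ctrlTau, if_pos hx, ctrlTau, ctrlTau,
      if_pos (controls_nil _), if_pos (hiff.mpr hx), Equiv.swap_apply_apply]
    simp [ctrlTau]
  · rw [Function.comp_apply, Function.comp_apply, ctrlTau, if_neg hx, ctrlTau, ctrlTau,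
      if_pos (controls_nil _), if_neg (mt hiff.mp hx)]
    simp [ctrlTau]

theorem Realizes.ctrlTau_of_same_block {L : List (ι × A)} {j : ι} (hL : ∀ p ∈ L, p.1 ≠ j)
    {a b a' b' : A} (h : Realizes S (ctrlTau L j a b))
    (hT : ∀ (j : ι) (a b : A), blk a = blk b → Realizes S (ctrlTau [] j a b))
    (hab : a ≠ b) (hab' : a' ≠ b') (ha : blk a = blk a')
    (hb : blk b = blk b') : Realizes S (ctrlTau L j a' b') := by
  have h₁ := h.ctrlTau_symbols hL (hT j a a' ha)
  rw [Equiv.swap_apply_left] at h₁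
  set d := Equiv.swap a a' b with hd
  have hd₁ : a' ≠ d := fun h =>
    hab ((Equiv.swap a a').injective (by rw [Equiv.swap_apply_left]; exact h))
  have hd₂ : blk d = blk b' := by
    rw [hd, Equiv.swap_apply_def]
    split_ifs <;> simp_all
  have h₂ := h₁.ctrlTau_symbols hL (hT j d b' hd₂)
  rwa [Equiv.swap_apply_left, Equiv.swap_apply_of_ne_of_ne hd₁ hab'] at h₂

theorem Realizes.ctrlSwap_symbols {L : List (ι × A)} {i j : ι} (hij : i ≠ j)
    (hi : ∀ p ∈ L, p.1 ≠ i) (hj : ∀ p ∈ L, p.1 ≠ j) {a b d e : A}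
    (h : Realizes S (ctrlSwap L i j a b)) (hdi : Realizes S (ctrlTau [] i d e))
    (hdj : Realizes S (ctrlTau [] j d e)) :
    Realizes S (ctrlSwap L i j (Equiv.swap d e a) (Equiv.swap d e b)) := by
  have hd := hdi.comp hdj
  have key : ∀ x : ι → A, (ctrlTau [] i d e ∘ ctrlTau [] j d e) x = fun k =>
      if k = i ∨ k = j then Equiv.swap d e (x k) else x k := fun x => by
    ext k
    by_cases hki : k = i
    · subst hki
      simp [ctrlTau, hij]
    · by_cases hkj : k = j
      · subst hkj
        simp [ctrlTau, hki]
      · simp [ctrlTau, hki, hkj]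
  have hiff : ∀ x, Controls L ((ctrlTau [] i d e ∘ ctrlTau [] j d e) x) ↔ Controls L x :=
    fun x => (controls_ctrlTau hi _ _ _).trans (controls_ctrlTau hj _ _ _)
  generalize ctrlTau [] i d e ∘ ctrlTau [] j d e = D at hd key hiff
  convert hd.comp (h.comp hd) using 1
  ext x : 1
  rw [Function.comp_apply, Function.comp_apply, key (ctrlSwap _ _ _ _ _ _)]
  by_cases hx : Controls L x
  · rw [ctrlSwap, if_pos hx, ctrlSwap, if_pos ((hiff x).mpr hx), key]
    have hcond : ((x i = Equiv.swap d e a ∧ x j = Equiv.swap d e b) ∨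
        (x i = Equiv.swap d e b ∧ x j = Equiv.swap d e a)) ↔
        ((Equiv.swap d e (x i) = a ∧ Equiv.swap d e (x j) = b) ∨
        (Equiv.swap d e (x i) = b ∧ Equiv.swap d e (x j) = a)) := by
      simp [Equiv.swap_apply_eq_iff]
    ext k
    by_cases hki : k = i
    · subst hki
      simp only [swapCells, hcond]
      split_ifs <;> simp_all
    · by_cases hkj : k = j
      · subst hkj
        simp only [swapCells, hcond]
        split_ifs <;> simp_all
      · simp [swapCells_apply_of_ne hki hkj, hki, hkj]
  · rw [ctrlSwap, if_neg hx, ctrlSwap, if_neg (mt (hiff x).mp hx), key]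
    ext k
    by_cases hk : k = i ∨ k = j <;> simp [hk]

theorem realizes_ctrlTau_of_generates [Finite ι] {a b : A}
    (h : Generates S ⟨1, tau ![a] ![b]⟩) (j : ι) : Realizes S (ctrlTau [] j a b) := by
  refine Realizes.of_generates h (φ := fun _ => j) (Function.injective_of_subsingleton _)
    (fun x => ?_) fun x i hi => ?_
  · ext t
    have ha : ((x ∘ fun _ => j) = ![a]) ↔ x j = a := by simp [funext_iff]
    have hb : ((x ∘ fun _ => j) = ![b]) ↔ x j = b := by simp [funext_iff]
    simp only [tau, Equiv.swap_apply_def, ha, hb, ctrlTau]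
    split_ifs <;> simp_all
  · simp [ctrlTau, (hi 0).symm]

theorem realizes_ctrlTau_single_of_generates [Finite ι] {a b c : A}
    (h : Generates S ⟨2, tau ![c, a] ![c, b]⟩) {i j : ι} (hij : i ≠ j) :
    Realizes S (ctrlTau [(i, c)] j a b) := by
  refine Realizes.of_generates h (φ := ![i, j]) ?_ (fun x => ?_) fun x k hk => ?_
  · intro s t
    fin_cases s <;> fin_cases t <;> simp [hij, hij.symm]
  · have ha : ((x ∘ ![i, j]) = ![c, a]) ↔ x i = c ∧ x j = a := by simp [funext_iff]
    have hb : ((x ∘ ![i, j]) = ![c, b]) ↔ x i = c ∧ x j = b := by simp [funext_iff]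
    ext t
    simp only [tau, Equiv.swap_apply_def, ha, hb, ctrlTau, controls_cons, controls_nil, and_true]
    fin_cases t <;> (split_ifs <;> simp_all)
  · have := (hk 1).symm
    simp only [Matrix.cons_val_one, Matrix.cons_val_fin_one] at this
    simp only [ctrlTau]
    split_ifs <;> simp [this]

theorem controlled_splitEquiv_symm {l n : ℕ} (w : Fin l → A) (F : GateFun A n) (p : Fin l → A)
    (q : Fin n → A) : controlled w F ((splitEquiv A l n).symm (p, q)) =
      (splitEquiv A l n).symm (p, if p = w then F q else q) := by
  by_cases h : p = w <;> simp [controlled, h]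

theorem realizes_ctrlSwap_of_generates [Finite ι] {o a b : A}
    (h : Generates S ⟨1 + 2, controlled ![o] (swapGate a b)⟩) {k i j : ι} (hki : k ≠ i)
    (hkj : k ≠ j) (hij : i ≠ j) : Realizes S (ctrlSwap [(k, o)] i j a b) := by
  have hsplit : ∀ x : ι → A, x ∘ (![k, i, j] : Fin (1 + 2) → ι) =
      (splitEquiv A 1 2).symm (![x k], ![x i, x j]) := fun x => by
    ext t
    fin_cases t <;> rfl
  refine Realizes.of_generates h (φ := (![k, i, j] : Fin 3 → ι)) ?_ (fun x => ?_) fun x m hm => ?_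
  · intro s t
    fin_cases s <;> fin_cases t <;> simp [hki, hkj, hij, hki.symm, hkj.symm, hij.symm]
  · refine (hsplit _).trans (Eq.trans ?_ (congrArg _ (hsplit x).symm))
    rw [controlled_splitEquiv_symm]
    have ho : ![x k] = ![o] ↔ x k = o := by simp [funext_iff]
    have ha : ![x i, x j] = ![a, b] ↔ x i = a ∧ x j = b := by simp [funext_iff]
    have hb : ![x i, x j] = ![b, a] ↔ x i = b ∧ x j = a := by simp [funext_iff]
    simp only [ctrlSwap, controls_cons, controls_nil, and_true, ho, swapGate, tau,
      Equiv.swap_apply_def, ha, hb]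
    by_cases hk : x k = o
    · simp only [hk, if_true, swapCells_apply_of_ne hki hkj]
      congr 2
      by_cases h₁ : x i = a ∧ x j = b
      · simp [swapCells, h₁]
      · by_cases h₂ : x i = b ∧ x j = a
        · rw [if_neg h₁, if_pos h₂]
          simp [swapCells, h₂]
        · simp [swapCells, h₁, h₂]
    · simp [hk]
  · have h₁ : m ≠ i := (hm 1).symm
    have h₂ : m ≠ j := (hm 2).symm
    simp only [ctrlSwap]
    split_ifs
    · exact swapCells_apply_of_ne h₁ h₂ a b x
    · rfl

end Blocks

section Connectivity

theorem mem_submonoid_of_swap_mem {X Y : Type*} [Finite X] [DecidableEq X]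
    (M : Submonoid (Equiv.Perm X)) (q : X → Y)
    (hM : ∀ x y, q x = q y → Equiv.swap x y ∈ M) (F : Equiv.Perm X) (hF : ∀ x, q (F x) = q x) :
    F ∈ M := by
  have := Fintype.ofFinite X
  induction hn : F.support.card using Nat.strong_induction_on generalizing F with
  | _ n ih =>
    by_cases h : F = 1
    · exact h ▸ M.one_mem
    · obtain ⟨x, hx⟩ : ∃ x, F x ≠ x := by
        by_contra! h'
        exact h (Equiv.ext h')
      have hG := ih _ (hn ▸ Equiv.Perm.card_support_swap_mul hx) (Equiv.swap x (F x) * F)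
        (fun y => by
          rw [Equiv.Perm.mul_apply, ← hF y, Equiv.swap_apply_def]
          split_ifs <;> simp_all) rfl
      simpa using M.mul_mem (hM x (F x) (hF x).symm) hG

theorem exists_perm_of_card_fiber_eq {ι β : Type*} [Fintype ι] [DecidableEq β] {f g : ι → β}
    (h : ∀ c, (Finset.univ.filter fun i => f i = c).card =
      (Finset.univ.filter fun i => g i = c).card) :
    ∃ σ : Equiv.Perm ι, ∀ i, f (σ i) = g i := by
  have e : ∀ c, Nonempty ({i // g i = c} ≃ {i // f i = c}) := fun c =>
    Fintype.card_eq.mp (by simp [Fintype.card_subtype, h])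
  exact ⟨Equiv.ofFiberEquiv fun c => (e c).some, Equiv.ofFiberEquiv_map _⟩

variable {A : Type*} {ι : Type*} [Fintype ι] [DecidableEq ι]

/-- The controls fixing the symbols of `u` on all wires outside `s`. -/
noncomputable def controlsOff (u : ι → A) (s : Finset ι) : List (ι × A) :=
  sᶜ.toList.map fun i => (i, u i)

theorem controls_controlsOff {u x : ι → A} {s : Finset ι} :
    Controls (controlsOff u s) x ↔ ∀ i ∉ s, x i = u i := by
  simp [Controls, controlsOff]

theorem ne_of_mem_controlsOff {u : ι → A} {s : Finset ι} {j : ι} (hj : j ∈ s) :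
    ∀ p ∈ controlsOff u s, p.1 ≠ j := by
  simp only [controlsOff, List.forall_mem_map, Finset.mem_toList, Finset.mem_compl]
  rintro i hi rfl
  exact hi hj

variable [DecidableEq A]

theorem ctrlTau_controlsOff (u : ι → A) (j : ι) (b : A) :
    ctrlTau (controlsOff u {j}) j (u j) b = Equiv.swap u (Function.update u j b) := by
  ext x : 1
  by_cases hx : Controls (controlsOff u {j}) x
  · obtain ⟨v, rfl⟩ : ∃ v, x = Function.update u j v := by
      refine ⟨x j, ?_⟩
      ext i
      by_cases hi : i = j
      · subst hi
        simp
      · simpa [hi] using controls_controlsOff.mp hx i (by simpa using hi)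
    have h₁ : Function.update u j v = u ↔ v = u j := by simp
    have h₂ : Function.update u j v = Function.update u j b ↔ v = b :=
      (Function.update_injective u j).eq_iff
    rw [ctrlTau, if_pos hx]
    simp only [Equiv.swap_apply_def, h₁, h₂, Function.update_self, Function.update_idem]
    split_ifs <;> simp_all
  · rw [ctrlTau, if_neg hx, Equiv.swap_apply_of_ne_of_ne]
    · rintro rfl
      exact hx (controls_controlsOff.mpr fun _ _ => rfl)
    · rintro rfl
      exact hx (controls_controlsOff.mpr fun i hi => by simp_all)

theorem ctrlSwap_controlsOff (u : ι → A) {i j : ι} (hne : u i ≠ u j) :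
    ctrlSwap (controlsOff u {i, j}) i j (u i) (u j) = Equiv.swap u (u ∘ Equiv.swap i j) := by
  have hu : ∀ x, (x = u ↔ Controls (controlsOff u {i, j}) x ∧ x i = u i ∧ x j = u j) :=
    fun x => by
    rw [controls_controlsOff]
    refine ⟨by rintro rfl; simp, fun ⟨h, hi, hj⟩ => ?_⟩
    ext k
    by_cases hki : k = i
    · rw [hki, hi]
    · by_cases hkj : k = j
      · rw [hkj, hj]
      · exact h k (by simp [hki, hkj])
  have hu' : ∀ x, (x = u ∘ Equiv.swap i j ↔
      Controls (controlsOff u {i, j}) x ∧ x i = u j ∧ x j = u i) := fun x => by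
    rw [controls_controlsOff]
    refine ⟨?_, fun ⟨h, hi, hj⟩ => ?_⟩
    · rintro rfl
      refine ⟨fun k hk => ?_, by simp, by simp⟩
      simp only [Finset.mem_insert, Finset.mem_singleton, not_or] at hk
      simp [Equiv.swap_apply_of_ne_of_ne hk.1 hk.2]
    · ext k
      by_cases hki : k = i
      · simp [hki, hi]
      · by_cases hkj : k = j
        · simp [hkj, hj]
        · simpa [Equiv.swap_apply_of_ne_of_ne hki hkj] using h k (by simp [hki, hkj])
  ext x : 1
  rw [Equiv.swap_apply_def]
  split_ifs with h₁ h₂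
  · subst h₁
    have := (hu x).mp rfl
    simp [ctrlSwap, swapCells, this.1]
  · have := (hu' x).mp h₂
    rw [ctrlSwap, if_pos this.1, swapCells, if_pos (Or.inr this.2), h₂]
    ext k
    simp
  · rw [hu] at h₁
    rw [hu'] at h₂
    unfold ctrlSwap swapCells
    split_ifs <;> tauto

variable {S : Set (Gate A)} {β : Type*} {blk : A → β}

/-- Transpositions of states that agree up to a permutation of the wires and changes of symbols
within blocks are realized. -/
theorem swap_mem_realizedPerms
    (hT : ∀ (L : List (ι × A)) (j : ι) (a b : A), (∀ p ∈ L, p.1 ≠ j) → blk a = blk b →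
      Realizes S (ctrlTau L j a b))
    (hS : ∀ (L : List (ι × A)) (i j : ι) (a b : A), i ≠ j → (∀ p ∈ L, p.1 ≠ i) →
      (∀ p ∈ L, p.1 ≠ j) → blk a ≠ blk b → Realizes S (ctrlSwap L i j a b))
    {u v : ι → A} (σ : Equiv.Perm ι) (h : ∀ i, blk (u (σ i)) = blk (v i)) :
    Equiv.swap u v ∈ realizedPerms S ι := by
  have update_mem : ∀ (u : ι → A) (j : ι) (b : A), blk (u j) = blk b →
      Equiv.swap u (Function.update u j b) ∈ realizedPerms S ι := fun u j b hb => by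
    rw [mem_realizedPerms, ← ctrlTau_controlsOff]
    exact hT _ _ _ _ (ne_of_mem_controlsOff (by simp)) hb
  have letters_mem : ∀ u v : ι → A, (∀ i, blk (u i) = blk (v i)) →
      Equiv.swap u v ∈ realizedPerms S ι := fun u v huv => by
    suffices H : ∀ s : Finset ι, Equiv.swap u (s.piecewise v u) ∈ realizedPerms S ι by
      simpa using H Finset.univ
    intro s
    induction s using Finset.induction with
    | empty =>
      rw [Finset.piecewise_empty, Equiv.swap_self]
      exact one_mem _
    | insert i s hi ih =>
      rw [Finset.piecewise_insert]
      refine SubmonoidClass.swap_mem_trans _ ih (update_mem _ _ _ ?_)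
      simp [hi, huv]
  have wires_mem : ∀ (σ : Equiv.Perm ι) (u : ι → A),
      Equiv.swap u (u ∘ σ) ∈ realizedPerms S ι := fun σ => by
    induction σ using Equiv.Perm.swap_induction_on with
    | one =>
      intro u
      rw [Equiv.Perm.coe_one, Function.comp_id, Equiv.swap_self]
      exact one_mem _
    | swap_mul σ i j hij ih =>
      intro u
      rw [Equiv.Perm.coe_mul, ← Function.comp_assoc]
      refine SubmonoidClass.swap_mem_trans _ ?_ (ih _)
      by_cases hb : blk (u i) = blk (u j)
      · refine letters_mem _ _ fun k => ?_
        rw [Function.comp_apply, Equiv.swap_apply_def]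
        split_ifs <;> simp_all
      · rw [mem_realizedPerms, ← ctrlSwap_controlsOff u fun h => hb (congrArg blk h)]
        exact hS _ _ _ _ _ hij (ne_of_mem_controlsOff (by simp))
          (ne_of_mem_controlsOff (by simp)) hb
  exact SubmonoidClass.swap_mem_trans _ (wires_mem σ u) (letters_mem _ _ h)

end Connectivity

section Conservation

variable {A : Type*} [DecidableEq A] {S : Set (Gate A)}

theorem countIn_splitEquiv_symm (s : Finset A) {n m : ℕ} (a : Fin n → A) (b : Fin m → A) :
    countIn s ((splitEquiv A n m).symm (a, b)) = countIn s a + countIn s b := by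
  simp only [countIn, Finset.card_filter, splitEquiv_symm_eq, Function.comp_apply]
  rw [finSumFinEquiv.symm.sum_comp fun i => if Sum.elim a b i ∈ s then 1 else 0,
    Fintype.sum_sum_type]
  rfl

theorem countIn_comp_perm (s : Finset A) {n : ℕ} (x : Fin n → A) (σ : Equiv.Perm (Fin n)) :
    countIn s (x ∘ σ) = countIn s x := by
  simp only [countIn, Finset.card_filter, Function.comp_apply]
  exact Equiv.sum_comp σ fun i => if x i ∈ s then 1 else 0

theorem countIn_tau {s : Finset A} {n : ℕ} {u v : Fin n → A} (h : countIn s u = countIn s v)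
    (x : Fin n → A) : countIn s (tau u v x) = countIn s x := by
  simp only [tau, Equiv.swap_apply_def]
  split_ifs <;> simp_all

theorem Generates.countIn_eq {s : Finset A}
    (hS : ∀ g ∈ S, ∀ x : Fin g.1 → A, countIn s (g.2 x) = countIn s x) {g : Gate A}
    (hg : Generates S g) : ∀ x : Fin g.1 → A, countIn s (g.2 x) = countIn s x := by
  induction hg with
  | mem h => exact hS _ h
  | perm n σ => exact fun x => countIn_comp_perm s x σ
  | @tensor n m F G _ _ ihF ihG =>
    intro x
    obtain ⟨⟨a, b⟩, rfl⟩ := (splitEquiv A n m).symm.surjective x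
    simp only [tensorGate_splitEquiv_symm, countIn_splitEquiv_symm]
    exact congrArg₂ _ (ihF a) (ihG b)
  | comp _ _ ihF ihG => exact fun x => (ihF _).trans (ihG x)
  | ancilla a _ hF ih =>
    intro b
    have h := ih ((splitEquiv A _ _).symm (a, b))
    rw [hF, countIn_splitEquiv_symm, countIn_splitEquiv_symm] at h
    exact Nat.add_left_cancel h

end Conservation

/-- Here `λ` is a partition of `A = {1,…,k}` (`k ≥ 3`) given by disjoint nonempty blocks
`B i` covering `A`, and `S` is the generating set consisting of (1) `τ_{a,b}` for all
`a ≠ b` in a common block, (2) `τ_{aa,ab}` for one chosen pair `a = ca i ≠ cb i = b` in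
each block of size `> 1`, and (3) `1-SWAP_{a,b}` for one chosen pair `a = da i j ∈ B i`,
`b = db i j ∈ B j` for each `i < j`.
Then `⟨S⟩ = CONS_λ`, the class of `λ`-conservative gates. -/
theorem closure_eq_cons_lambda (k l : ℕ) (hk : 3 ≤ k)
    (B : Fin l → Finset (Fin k))
    (hne : ∀ i, (B i).Nonempty)
    (hdisj : ∀ i j, i ≠ j → Disjoint (B i) (B j))
    (hcover : ∀ x : Fin k, ∃ i, x ∈ B i)
    (ca cb : Fin l → Fin k)
    (hc : ∀ i, 1 < (B i).card → ca i ∈ B i ∧ cb i ∈ B i ∧ ca i ≠ cb i)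
    (da db : Fin l → Fin l → Fin k)
    (hd : ∀ i j, i < j → da i j ∈ B i ∧ db i j ∈ B j) :
    genClosure ({g : Gate (Fin k) | ∃ (i : Fin l) (a b : Fin k),
        a ∈ B i ∧ b ∈ B i ∧ a ≠ b ∧ g = ⟨1, tau ![a] ![b]⟩} ∪
      {g : Gate (Fin k) | ∃ i : Fin l, 1 < (B i).card ∧
        g = ⟨2, tau ![ca i, ca i] ![ca i, cb i]⟩} ∪
      {g : Gate (Fin k) | ∃ i j : Fin l, i < j ∧
        g = ⟨1 + 2, controlled ![(⟨0, by omega⟩ : Fin k)]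
          (swapGate (da i j) (db i j))⟩}) =
      {g : Gate (Fin k) | ∀ (x : Fin g.1 → Fin k) (i : Fin l),
        countIn (B i) (g.2 x) = countIn (B i) x} := by
  choose blk hblk using hcover
  have mem_iff : ∀ x i, x ∈ B i ↔ blk x = i := fun x i =>
    ⟨fun hx => by_contra fun h =>
      Finset.disjoint_left.mp (hdisj _ _ h) (hblk x) hx, fun h => h ▸ hblk x⟩
  have countIn_eq : ∀ i n (x : Fin n → Fin k),
      countIn (B i) x = (Finset.univ.filter fun t => blk (x t) = i).card := fun i n x => by
    simp only [countIn, mem_iff]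
  apply Set.Subset.antisymm
  · intro g hg x i
    refine Generates.countIn_eq (fun g hg => ?_) hg x
    rcases hg with (⟨j, a, b, ha, hb, -, rfl⟩ | ⟨j, hj, rfl⟩) | ⟨j, j', hj, rfl⟩
    · refine countIn_tau ?_
      rw [mem_iff] at ha hb
      simp [countIn_eq, ha, hb]
    · obtain ⟨ha, hb, -⟩ := hc j hj
      refine countIn_tau ?_
      rw [mem_iff] at ha hb
      simp only [countIn_eq, Finset.card_filter, Fin.sum_univ_two]
      simp [ha, hb]
    · intro x
      obtain ⟨⟨a, b⟩, rfl⟩ := (splitEquiv _ 1 2).symm.surjective x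
      dsimp only
      rw [controlled_splitEquiv_symm, countIn_splitEquiv_symm, countIn_splitEquiv_symm]
      congr 1
      split_ifs
      · refine countIn_tau ?_ b
        simp only [countIn, Finset.card_filter, Fin.sum_univ_two]
        exact add_comm _ _
      · rfl
  · set S : Set (Gate (Fin k)) := _ ∪ _ ∪ _
    have hT : ∀ {ι : Type} [Finite ι] [DecidableEq ι] (j : ι) (a b : Fin k), blk a = blk b →
        Realizes S (ctrlTau [] j a b) := by
      intro ι _ _ j a b hab
      by_cases h : a = b
      · rw [h, ctrlTau_self]
        exact .id
      · exact realizes_ctrlTau_of_generates (.mem (.inl (.inl ⟨blk a, a, b, hblk a,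
          hab ▸ hblk b, h, rfl⟩))) j
    have hC : ∀ {ι : Type} [Finite ι] [DecidableEq ι] (i j : ι) (c a b : Fin k), i ≠ j →
        blk c = blk a → blk c = blk b → Realizes S (ctrlTau [(i, c)] j a b) := by
      intro ι _ _ i j c a b hij hca hcb
      by_cases h : a = b
      · rw [h, ctrlTau_self]
        exact .id
      have hcard : 1 < (B (blk c)).card :=
        Finset.one_lt_card.mpr ⟨a, hca ▸ hblk a, b, hcb ▸ hblk b, h⟩
      obtain ⟨h₁, h₂, h₁₂⟩ := hc _ hcard
      have h₀ : Realizes S (ctrlTau [(i, ca (blk c))] j (ca (blk c)) (cb (blk c))) :=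
        realizes_ctrlTau_single_of_generates (.mem (.inl (.inr ⟨blk c, hcard, rfl⟩))) hij
      rw [mem_iff] at h₁ h₂
      have hL : ∀ p ∈ [(i, c)], p.1 ≠ j := by simpa using hij
      exact (h₀.ctrlTau_control hij (hT i _ _ h₁)).ctrlTau_of_same_block hL hT h₁₂ h
        (h₁.trans hca) (h₂.trans hcb)
    have hF : ∀ {ι : Type} [Finite ι] [DecidableEq ι] (m i j : ι) (a b : Fin k), m ≠ i →
        m ≠ j → i ≠ j → blk a ≠ blk b →
        Realizes S (ctrlSwap [(m, ⟨0, by omega⟩)] i j a b) := by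
      intro ι _ _ m i j a b hmi hmj hij hab
      wlog hlt : blk a < blk b generalizing a b
      · rw [ctrlSwap_symbols_comm]
        exact this b a hab.symm (lt_of_le_of_ne (not_lt.mp hlt) hab.symm)
      obtain ⟨h₁, h₂⟩ := hd _ _ hlt
      have h₀ : Realizes S (ctrlSwap [(m, ⟨0, by omega⟩)] i j (da (blk a) (blk b))
          (db (blk a) (blk b))) :=
        realizes_ctrlSwap_of_generates (.mem (.inr ⟨_, _, hlt, rfl⟩)) hmi hmj hij
      rw [mem_iff] at h₁ h₂
      have hLi : ∀ p ∈ [(m, (⟨0, by omega⟩ : Fin k))], p.1 ≠ i := by simpa using hmi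
      have hLj : ∀ p ∈ [(m, (⟨0, by omega⟩ : Fin k))], p.1 ≠ j := by simpa using hmj
      have h₃ := h₀.ctrlSwap_symbols hij hLi hLj (hT i _ _ h₁) (hT j _ _ h₁)
      rw [Equiv.swap_apply_left, Equiv.swap_apply_of_ne_of_ne
        (fun h => hab (h₁.symm.trans ((congrArg blk h).symm.trans h₂)))
        (fun h => hab ((congrArg blk h).symm.trans h₂))] at h₃
      have h₄ := h₃.ctrlSwap_symbols hij hLi hLj (hT i _ _ h₂) (hT j _ _ h₂)
      rwa [Equiv.swap_apply_left, Equiv.swap_apply_of_ne_of_ne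
        (fun h => hab ((congrArg blk h).trans h₂)) (fun h => hab (congrArg blk h))] at h₄
    rintro ⟨n, F⟩ hg
    have hall : ∀ L : List (Fin n × Fin k), _ := realizes_controlled
      (a₀ := (⟨0, by omega⟩ : Fin k)) (b₀ := ⟨1, by omega⟩) (c₀ := ⟨2, by omega⟩) (by simp)
      (by simp) (by simp) ⟨0, by omega⟩ hT hC hF
    have hFS : F ∈ realizedPerms S (Fin n) := by
      refine mem_submonoid_of_swap_mem _ (fun x i => countIn (B i) x) (fun x y hxy => ?_) F
        fun x => funext (hg x)
      obtain ⟨σ, hσ⟩ := exists_perm_of_card_fiber_eq (f := blk ∘ x) (g := blk ∘ y) fun c => by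
        simpa only [countIn_eq, Function.comp_apply] using congrFun hxy c
      exact swap_mem_realizedPerms (fun L => (hall L).1) (fun L => (hall L).2) σ hσ
    obtain ⟨G, hG, hGF⟩ := Realizes.exists_gate hFS (Equiv.refl (Fin n))
    obtain rfl : F = G := Equiv.ext hGF
    exact hG
end

section
/- Let A = {1,…,k} with k ≥ 3, let λ = {λ_1,…,λ_l} be a partition of A, and let S be the generating set from Theorem LmConsGeneration: (1) τ_{a,b} for all 1 ≤ i ≤ l and all a ≠ b ∈ λ_i; (2) τ_{aa,ab} for each 1 ≤ i ≤ l with |λ_i| > 1 and one chosen pair a ≠ b ∈ λ_i; (3) 1-SWAP_{a,b} for each 1 ≤ i < j ≤ l and one chosen pair a ∈ λ_i, b ∈ λ_j. Then for every 1 ≤ i ≤ l, S generates every reversible gate that fixes all inputs containing at least one symbol not in λ_i. -/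
section Wires

variable {A : Type*} {ι κ : Type} {n m : ℕ}

/-- Renaming the wires of a gate along a bijection of index types. -/
def relabel (e : ι ≃ κ) (F : Equiv.Perm (ι → A)) : Equiv.Perm (κ → A) :=
  (Equiv.arrowCongr e (Equiv.refl A)).permCongr F

theorem relabel_apply (e : ι ≃ κ) (F : Equiv.Perm (ι → A)) (x : κ → A) :
    relabel e F x = F (x ∘ e) ∘ e.symm := rfl

/-- Applying a gate with wires `ι` to the wires `f i` of a larger register `κ`. -/
noncomputable def actOn (f : ι → κ) (hf : f.Injective) (F : Equiv.Perm (ι → A)) :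
    Equiv.Perm (κ → A) where
  toFun x := Function.extend f (F (x ∘ f)) x
  invFun x := Function.extend f (F.symm (x ∘ f)) x
  left_inv x := by
    funext j
    by_cases h : ∃ i, f i = j
    · obtain ⟨i, rfl⟩ := h
      dsimp only
      rw [hf.extend_apply, Function.extend_comp hf]
      simp
    · simp [Function.extend_apply' _ _ _ h]
  right_inv x := by
    funext j
    by_cases h : ∃ i, f i = j
    · obtain ⟨i, rfl⟩ := h
      dsimp only
      rw [hf.extend_apply, Function.extend_comp hf]
      simp
    · simp [Function.extend_apply' _ _ _ h]

theorem actOn_apply (f : ι → κ) (hf : f.Injective) (F : Equiv.Perm (ι → A)) (x : κ → A) :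
    actOn f hf F x = Function.extend f (F (x ∘ f)) x := rfl

theorem splitEquiv_apply (x : Fin (n + m) → A) :
    splitEquiv A n m x = (x ∘ Fin.castAdd m, x ∘ Fin.natAdd n) := rfl

theorem splitEquiv_symm_castAdd (p : (Fin n → A) × (Fin m → A)) (i : Fin n) :
    (splitEquiv A n m).symm p (Fin.castAdd m i) = p.1 i := by
  have := congrArg (fun q => q.1 i) ((splitEquiv A n m).apply_symm_apply p)
  exact this

theorem splitEquiv_symm_natAdd (p : (Fin n → A) × (Fin m → A)) (i : Fin m) :
    (splitEquiv A n m).symm p (Fin.natAdd n i) = p.2 i := by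
  have := congrArg (fun q => q.2 i) ((splitEquiv A n m).apply_symm_apply p)
  exact this

/-- `IsGen S F` means that the gate `F`, with wires indexed by an arbitrary finite type, is
generated by `S` (for every enumeration of its wires). -/
def IsGen (S : Set (Gate A)) (F : Equiv.Perm (ι → A)) : Prop :=
  ∀ (n : ℕ) (e : ι ≃ Fin n), Generates S ⟨n, relabel e F⟩

variable {S : Set (Gate A)}

theorem IsGen.of_equiv {F : Equiv.Perm (ι → A)} (e : ι ≃ Fin n)
    (h : Generates S ⟨n, relabel e F⟩) : IsGen S F := by
  intro m e'
  obtain rfl : n = m := by simpa using Fintype.card_congr (e.symm.trans e')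
  have key : relabel e' F = ((permGate A (e'.symm.trans e).symm).trans (relabel e F)).trans
      (permGate A (e'.symm.trans e)) := by
    apply Equiv.ext
    intro x
    funext j
    simp [relabel_apply, permGate, Function.comp_def, Equiv.arrowCongr]
  rw [key]
  exact .comp (.perm _ _) (.comp h (.perm _ _))

theorem Generates.isGen {F : GateFun A n} (h : Generates S ⟨n, F⟩) : IsGen S F :=
  .of_equiv (Equiv.refl _) h

theorem IsGen.generates {F : GateFun A n} (h : IsGen S F) : Generates S ⟨n, F⟩ :=
  h n (Equiv.refl _)

theorem IsGen.one : IsGen S (1 : Equiv.Perm (ι → A)) := fun n e => by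
  have : relabel e (1 : Equiv.Perm (ι → A)) = permGate A 1 := by
    apply Equiv.ext
    intro x
    funext j
    simp [relabel_apply, permGate, Equiv.arrowCongr]
  rw [this]
  exact .perm _ _

theorem IsGen.mul {F G : Equiv.Perm (ι → A)} (hF : IsGen S F) (hG : IsGen S G) :
    IsGen S (F * G) := fun n e => by
  have : relabel e (F * G) = (relabel e G).trans (relabel e F) := by
    apply Equiv.ext
    intro x
    simp [relabel_apply, Function.comp_assoc]
  rw [this]
  exact .comp (hF n e) (hG n e)

theorem IsGen.inv [Finite A] [Finite ι] {F : Equiv.Perm (ι → A)} (hF : IsGen S F) :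
    IsGen S F⁻¹ := by
  have hpow : ∀ j : ℕ, IsGen S (F ^ j) := fun j => by
    induction j with
    | zero => exact .one
    | succ j ih => exact pow_succ F j ▸ ih.mul hF
  have : F ^ (orderOf F - 1) = F⁻¹ := by
    rw [eq_inv_iff_mul_eq_one, ← pow_succ, Nat.sub_add_cancel (orderOf_pos F), pow_orderOf_eq_one]
  exact this ▸ hpow _

/-- The group of gates with wires `ι` generated by `S`. -/
def genGroup [Finite A] (S : Set (Gate A)) (ι : Type) [Finite ι] :
    Subgroup (Equiv.Perm (ι → A)) where
  carrier := {F | IsGen S F}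
  one_mem' := IsGen.one
  mul_mem' := IsGen.mul
  inv_mem' := IsGen.inv

theorem IsGen.relabel {F : Equiv.Perm (ι → A)} (hF : IsGen S F) (e : ι ≃ κ) :
    IsGen S (_root_.relabel e F) := fun n e' => hF n (e.trans e')

theorem IsGen.actOn [Finite κ] {F : Equiv.Perm (ι → A)} (hF : IsGen S F) {f : ι → κ}
    (hf : f.Injective) : IsGen S (actOn f hf F) := by
  classical
  have := Finite.of_injective f hf
  obtain ⟨n, ⟨e⟩⟩ := Finite.exists_equiv_fin ι
  obtain ⟨m, ⟨e'⟩⟩ := Finite.exists_equiv_fin ↥(Set.range f)ᶜ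
  let E : κ ≃ Fin (n + m) := ((Equiv.Set.sumCompl (Set.range f)).symm.trans
    (Equiv.sumCongr ((Equiv.ofInjective f hf).symm.trans e) e')).trans finSumFinEquiv
  have hE1 : ∀ i, E.symm (Fin.castAdd m i) = f (e.symm i) := fun i => by simp [E]
  have hE2 : ∀ i, E.symm (Fin.natAdd n i) = (e'.symm i : κ) := fun i => by simp [E]
  refine .of_equiv E ?_
  have key : _root_.relabel E (_root_.actOn f hf F) =
      tensorGate (_root_.relabel e F) (permGate A (1 : Equiv.Perm (Fin m))) := by
    apply Equiv.ext
    intro x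
    have hx : (x ∘ E) ∘ f = (x ∘ Fin.castAdd m) ∘ e := by
      funext i
      have : E (f i) = Fin.castAdd m (e i) := by rw [← E.eq_symm_apply]; simp [hE1]
      simp [this]
    funext j
    refine Fin.addCases (fun i => ?_) (fun i => ?_) j
    · simp [relabel_apply, actOn_apply, tensorGate, splitEquiv_apply, splitEquiv_symm_castAdd,
        hE1, hf.extend_apply, hx]
    · have h' : ¬ ∃ i', f i' = (e'.symm i : κ) := (e'.symm i).2
      have : E (e'.symm i : κ) = Fin.natAdd n i := by rw [← E.eq_symm_apply]; simp [hE2]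
      simp [relabel_apply, actOn_apply, tensorGate, splitEquiv_apply, splitEquiv_symm_natAdd,
        hE2, Function.extend_apply' _ _ _ h', this, permGate, Equiv.arrowCongr]
  rw [key]
  exact .tensor (hF n e) (.perm _ _)

theorem IsGen.ancilla [Finite κ] {G : Equiv.Perm (κ → A)} (hG : IsGen S G) {f : ι → κ}
    (hf : f.Injective) (a : κ → A) {F : Equiv.Perm (ι → A)}
    (h : ∀ x, G (Function.extend f x a) = Function.extend f (F x) a) : IsGen S F := by
  classical
  have := Finite.of_injective f hf
  obtain ⟨m, ⟨e⟩⟩ := Finite.exists_equiv_fin ι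
  obtain ⟨n, ⟨e'⟩⟩ := Finite.exists_equiv_fin ↥(Set.range f)ᶜ
  let E : κ ≃ Fin (n + m) := (((Equiv.Set.sumCompl (Set.range f)).symm.trans
    (Equiv.sumCongr ((Equiv.ofInjective f hf).symm.trans e) e')).trans
      (Equiv.sumComm _ _)).trans finSumFinEquiv
  have hE1 : ∀ i, E.symm (Fin.natAdd n i) = f (e.symm i) := fun i => by simp [E]
  have hE2 : ∀ i, E.symm (Fin.castAdd m i) = (e'.symm i : κ) := fun i => by simp [E]
  have hsplit : ∀ x : Fin m → A,
      (splitEquiv A n m).symm (fun i => a (e'.symm i), x) =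
        Function.extend f (x ∘ e) a ∘ E.symm := fun x => by
    funext j
    refine Fin.addCases (fun i => ?_) (fun i => ?_) j
    · have h' : ¬ ∃ i', f i' = (e'.symm i : κ) := (e'.symm i).2
      simp [splitEquiv_symm_castAdd, hE2, Function.extend_apply' _ _ _ h']
    · simp [splitEquiv_symm_natAdd, hE1, hf.extend_apply]
  refine .of_equiv e (.ancilla (fun i => a (e'.symm i)) (hG _ E) fun x => ?_)
  rw [hsplit, hsplit, relabel_apply, Function.comp_assoc]
  simp [h, relabel_apply, Function.comp_assoc]

/-- The gate acting on every wire `i` by the permutation `σ i` of the alphabet. -/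
theorem IsGen.piCongrRight [Finite A] [Finite ι] {σ : ι → Equiv.Perm A}
    (hσ : ∀ i, IsGen S (Equiv.piCongrRight fun _ : Unit => σ i)) :
    IsGen S (Equiv.piCongrRight σ) := by
  classical
  have := Fintype.ofFinite ι
  suffices H : ∀ s : Finset ι,
      IsGen S (Equiv.piCongrRight fun i => if i ∈ s then σ i else 1) by
    simpa using H Finset.univ
  intro s
  induction s using Finset.induction_on with
  | empty =>
    have : (Equiv.piCongrRight fun i : ι => if i ∈ (∅ : Finset ι) then σ i else 1) = 1 := by
      ext x i
      simp
    exact this ▸ IsGen.one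
  | insert i s hi ih =>
    have hinj : Function.Injective fun _ : Unit => i := fun _ _ _ => rfl
    have : (Equiv.piCongrRight fun j => if j ∈ insert i s then σ j else 1) =
        _root_.actOn _ hinj (Equiv.piCongrRight fun _ : Unit => σ i) *
          Equiv.piCongrRight fun j => if j ∈ s then σ j else 1 := by
      apply Equiv.ext
      intro x
      funext j
      rw [Equiv.Perm.mul_apply, actOn_apply]
      by_cases hj : j = i
      · subst hj
        have := hinj.extend_apply
          (Equiv.piCongrRight (fun _ : Unit => σ j)
            (((Equiv.piCongrRight fun j => if j ∈ s then σ j else 1) x) ∘ fun _ : Unit => j))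
          ((Equiv.piCongrRight fun j => if j ∈ s then σ j else 1) x) ()
        rw [this]
        simp [hi]
      · have h' : ¬ ∃ _ : Unit, i = j := fun ⟨_, h⟩ => hj h.symm
        rw [Function.extend_apply' _ _ _ h']
        simp [hj]
    exact this ▸ ((hσ i).actOn hinj).mul ih

end Wires

section Swaps

variable {A : Type*} {ι κ : Type} {S : Set (Gate A)}

theorem actOn_of_fixed {f : ι → κ} (hf : f.Injective) {F : Equiv.Perm (ι → A)} {x : κ → A}
    (h : F (x ∘ f) = x ∘ f) : actOn f hf F x = x := by
  rw [actOn_apply, h]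
  funext j
  by_cases hj : ∃ i, f i = j
  · obtain ⟨i, rfl⟩ := hj
    rw [hf.extend_apply]
    rfl
  · rw [Function.extend_apply' _ _ _ hj]

theorem extend_fin_two [DecidableEq κ] {f : Fin 2 → κ} (hf : f.Injective) (v : Fin 2 → A)
    (x : κ → A) :
    Function.extend f v x = Function.update (Function.update x (f 0) (v 0)) (f 1) (v 1) := by
  funext j
  by_cases hj : ∃ i, f i = j
  · obtain ⟨i, rfl⟩ := hj
    have := hf.ne (a₁ := 0) (a₂ := 1) (by decide)
    rw [hf.extend_apply]
    fin_cases i <;> simp [this]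
  · rw [Function.extend_apply' _ _ _ hj]
    push Not at hj
    simp [(hj _).symm]

theorem extend_fin_three [DecidableEq κ] {f : Fin 3 → κ} (hf : f.Injective) (v : Fin 3 → A)
    (x : κ → A) :
    Function.extend f v x =
      Function.update (Function.update (Function.update x (f 0) (v 0)) (f 1) (v 1))
        (f 2) (v 2) := by
  funext j
  by_cases hj : ∃ i, f i = j
  · obtain ⟨i, rfl⟩ := hj
    have h01 := hf.ne (a₁ := 0) (a₂ := 1) (by decide)
    have h02 := hf.ne (a₁ := 0) (a₂ := 2) (by decide)
    have h12 := hf.ne (a₁ := 1) (a₂ := 2) (by decide)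
    rw [hf.extend_apply]
    fin_cases i <;> simp [h01, h02, h12]
  · rw [Function.extend_apply' _ _ _ hj]
    push Not at hj
    simp [(hj _).symm]

theorem eq_vec_three (x : Fin 3 → A) : ∃ p q r, x = ![p, q, r] :=
  ⟨x 0, x 1, x 2, by ext j; fin_cases j <;> rfl⟩

theorem update_vec_four (p q r s t : A) :
    Function.update ![p, q, r, s] 0 t = ![t, q, r, s] ∧
    Function.update ![p, q, r, s] 1 t = ![p, t, r, s] ∧
    Function.update ![p, q, r, s] 2 t = ![p, q, t, s] ∧
    Function.update ![p, q, r, s] 3 t = ![p, q, r, t] := by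
  refine ⟨?_, ?_, ?_, ?_⟩ <;> ext j <;> fin_cases j <;> rfl

theorem update_vec_five (p q r s t z : A) :
    Function.update ![p, q, r, s, t] 0 z = ![z, q, r, s, t] ∧
    Function.update ![p, q, r, s, t] 1 z = ![p, z, r, s, t] ∧
    Function.update ![p, q, r, s, t] 2 z = ![p, q, z, s, t] ∧
    Function.update ![p, q, r, s, t] 3 z = ![p, q, r, z, t] ∧
    Function.update ![p, q, r, s, t] 4 z = ![p, q, r, s, z] := by
  refine ⟨?_, ?_, ?_, ?_, ?_⟩ <;> ext j <;> fin_cases j <;> rfl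

theorem swap_two_apply [DecidableEq A] (c u v p q : A) :
    Equiv.swap ![c, u] ![c, v] ![p, q] = if p = c then ![p, Equiv.swap u v q] else ![p, q] := by
  simp only [Equiv.swap_apply_def, Matrix.vecCons_inj]
  split_ifs <;> simp_all

theorem swap_three_apply [DecidableEq A] (c d u v p q r : A) :
    Equiv.swap ![c, d, u] ![c, d, v] ![p, q, r] =
      if p = c ∧ q = d then ![p, q, Equiv.swap u v r] else ![p, q, r] := by
  simp only [Equiv.swap_apply_def, Matrix.vecCons_inj]
  split_ifs <;> simp_all

theorem swap_exchange_apply [DecidableEq A] (c u v p q r : A) :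
    Equiv.swap ![c, u, v] ![c, v, u] ![p, q, r] =
      if p = c ∧ (q = u ∧ r = v ∨ q = v ∧ r = u) then ![p, r, q] else ![p, q, r] := by
  simp only [Equiv.swap_apply_def, Matrix.vecCons_inj]
  split_ifs <;> grind

theorem actOn_two [DecidableEq κ] {i j : κ} (h : Function.Injective ![i, j])
    (F : Equiv.Perm (Fin 2 → A)) (x : κ → A) :
    actOn ![i, j] h F x =
      Function.update (Function.update x i (F ![x i, x j] 0)) j (F ![x i, x j] 1) := by
  have : x ∘ ![i, j] = ![x i, x j] := by
    funext t
    fin_cases t <;> rfl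
  rw [actOn_apply, extend_fin_two h, this]
  rfl

theorem actOn_three [DecidableEq κ] {i j l : κ} (h : Function.Injective ![i, j, l])
    (F : Equiv.Perm (Fin 3 → A)) (x : κ → A) :
    actOn ![i, j, l] h F x =
      Function.update (Function.update (Function.update x i (F ![x i, x j, x l] 0))
        j (F ![x i, x j, x l] 1)) l (F ![x i, x j, x l] 2) := by
  have : x ∘ ![i, j, l] = ![x i, x j, x l] := by
    funext t
    fin_cases t <;> rfl
  rw [actOn_apply, extend_fin_three h, this]
  rfl

variable [DecidableEq A]

theorem actOn_control [DecidableEq κ] {i j : κ} (h : Function.Injective ![i, j]) (c u v : A)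
    (x : κ → A) :
    actOn ![i, j] h (Equiv.swap ![c, u] ![c, v]) x =
      if x i = c then Function.update x j (Equiv.swap u v (x j)) else x := by
  rw [actOn_two, swap_two_apply]
  split_ifs <;> simp

theorem actOn_exchange [DecidableEq κ] {i j l : κ} (h : Function.Injective ![i, j, l])
    (c u v : A) (x : κ → A) :
    actOn ![i, j, l] h (Equiv.swap ![c, u, v] ![c, v, u]) x =
      if x i = c ∧ (x j = u ∧ x l = v ∨ x j = v ∧ x l = u) then
        Function.update (Function.update x j (x l)) l (x j) else x := by
  rw [actOn_three, swap_exchange_apply]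
  split_ifs <;> simp

/-- With three letters, two controls can be recorded in a single auxiliary wire. -/
theorem isGen_swap_three_of_three_letters {a b c : A} (hab : a ≠ b) (hac : a ≠ c) (hbc : b ≠ c)
    (h₁ : IsGen S (Equiv.swap ![a, a] ![a, b])) (h₂ : IsGen S (Equiv.swap ![a, b] ![a, c]))
    (h₃ : IsGen S (Equiv.swap ![c, a] ![c, b])) :
    IsGen S (Equiv.swap ![a, a, a] ![a, a, b]) := by
  have i₁ : Function.Injective (![0, 3] : Fin 2 → Fin 4) := by decide
  have i₂ : Function.Injective (![1, 3] : Fin 2 → Fin 4) := by decide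
  have i₃ : Function.Injective (![3, 2] : Fin 2 → Fin 4) := by decide
  have i : Function.Injective (![0, 1, 2] : Fin 3 → Fin 4) := by decide
  refine IsGen.ancilla ((h₁.actOn i₁).mul ((h₂.actOn i₂).mul ((h₃.actOn i₃).mul
    ((h₂.actOn i₂).mul (h₁.actOn i₁))))) i (fun _ => a) fun x => ?_
  obtain ⟨p, q, r, rfl⟩ := eq_vec_three x
  have hext : ∀ y : Fin 3 → A,
      Function.extend (![0, 1, 2] : Fin 3 → Fin 4) y (fun _ => a) = ![y 0, y 1, y 2, a] := by
    intro y
    rw [extend_fin_three i]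
    ext j
    fin_cases j <;> rfl
  rw [hext, hext, swap_three_apply]
  simp only [Equiv.Perm.mul_apply, actOn_control]
  by_cases hp : p = a <;> by_cases hq : q = a <;>
    simp [hp, hq, update_vec_four, hab, hac, hbc,
      Equiv.swap_apply_of_ne_of_ne]

/-- With a letter `c` outside the block, a controlled exchange with `c` disables a gate. -/
theorem isGen_swap_three_of_exchange {a b c : A} (hac : a ≠ c)
    (h₁ : IsGen S (Equiv.swap ![a, a] ![a, b]))
    (h₂ : IsGen S (Equiv.swap ![a, a, c] ![a, c, a])) :
    IsGen S (Equiv.swap ![a, a, a] ![a, a, b]) := by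
  have i₁ : Function.Injective (![1, 2] : Fin 2 → Fin 4) := by decide
  have i₂ : Function.Injective (![0, 1, 3] : Fin 3 → Fin 4) := by decide
  have i : Function.Injective (![0, 1, 2] : Fin 3 → Fin 4) := by decide
  refine IsGen.ancilla ((h₂.actOn i₂).mul ((h₁.actOn i₁).mul ((h₂.actOn i₂).mul
    (h₁.actOn i₁)))) i (fun _ => c) fun x => ?_
  obtain ⟨p, q, r, rfl⟩ := eq_vec_three x
  have hext : ∀ y : Fin 3 → A,
      Function.extend (![0, 1, 2] : Fin 3 → Fin 4) y (fun _ => c) = ![y 0, y 1, y 2, c] := by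
    intro y
    rw [extend_fin_three i]
    ext j
    fin_cases j <;> rfl
  rw [hext, hext, swap_three_apply]
  simp only [Equiv.Perm.mul_apply, actOn_control, actOn_exchange]
  by_cases hp : p = a <;> by_cases hq : q = a <;>
    simp [hp, hq, update_vec_four, hac, hac.symm]

/-- An exchange of `a` and `c` controlled by `c` yields one controlled by `a`. -/
theorem isGen_exchange_control {a c : A} (hac : a ≠ c)
    (h : IsGen S (Equiv.swap ![c, a, c] ![c, c, a])) :
    IsGen S (Equiv.swap ![a, a, c] ![a, c, a]) := by
  have i₁ : Function.Injective (![3, 0, 4] : Fin 3 → Fin 5) := by decide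
  have i₂ : Function.Injective (![0, 1, 2] : Fin 3 → Fin 5) := by decide
  refine IsGen.ancilla ((h.actOn i₁).mul ((h.actOn i₂).mul ((h.actOn i₁).mul
    (h.actOn i₂)))) i₂ (fun _ => c) fun x => ?_
  obtain ⟨p, q, r, rfl⟩ := eq_vec_three x
  have hext : ∀ y : Fin 3 → A,
      Function.extend (![0, 1, 2] : Fin 3 → Fin 5) y (fun _ => c) =
        ![y 0, y 1, y 2, c, c] := by
    intro y
    rw [extend_fin_three i₂]
    ext j
    fin_cases j <;> rfl
  rw [hext, hext, swap_exchange_apply]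
  simp only [Equiv.Perm.mul_apply, actOn_exchange]
  by_cases hp : p = a
  · subst hp
    by_cases hq : q = p ∧ r = c ∨ q = c ∧ r = p <;>
      simp [hq, update_vec_five, hac, hac.symm]
  · by_cases hpc : p = c
    · subst hpc
      by_cases hq : q = a ∧ r = p ∨ q = p ∧ r = a
      · have hq' : r = a ∧ q = p ∨ r = p ∧ q = a := by tauto
        simp [hq, hq', update_vec_five, hac.symm]
      · simp [hq, hac.symm]
    · simp [hp, hpc]

end Swaps

section Blocks

variable {A : Type*} {S : Set (Gate A)} {B : Finset A} {κ κ' : Type}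

/-- The unary gate given by a permutation of the alphabet is generated by `S`. -/
def IsUnaryGen (S : Set (Gate A)) (σ : Equiv.Perm A) : Prop :=
  IsGen S (Equiv.piCongrRight fun _ : Unit => σ)

theorem IsUnaryGen.mul {σ τ : Equiv.Perm A} (hσ : IsUnaryGen S σ) (hτ : IsUnaryGen S τ) :
    IsUnaryGen S (σ * τ) :=
  IsGen.mul hσ hτ

theorem isUnaryGen_swap [DecidableEq A] {a b : A} (h : Generates S ⟨1, tau ![a] ![b]⟩) :
    IsUnaryGen S (Equiv.swap a b) := by
  have key : relabel (Equiv.equivPUnit (Fin 1)) (tau ![a] ![b]) =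
      Equiv.piCongrRight fun _ : Unit => Equiv.swap a b := by
    apply Equiv.ext
    intro x
    funext i
    have hx : ∀ c, x ∘ Equiv.equivPUnit (Fin 1) = ![c] ↔ x i = c := fun c =>
      ⟨fun h => congrFun h 0, fun h => by funext j; fin_cases j; exact h⟩
    simp only [relabel_apply, tau, Equiv.swap_apply_def, hx, Equiv.piCongrRight_apply,
      Pi.map_apply]
    split_ifs <;> rfl
  rw [IsUnaryGen, ← key]
  exact h.isGen.relabel _

theorem exists_isUnaryGen_pair [DecidableEq A]
    (hB : ∀ a ∈ B, ∀ b ∈ B, IsUnaryGen S (Equiv.swap a b))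
    {a b a' b' : A} (ha : a ∈ B) (hb : b ∈ B) (ha' : a' ∈ B) (hb' : b' ∈ B) (hab : a ≠ b)
    (hab' : a' ≠ b') : ∃ σ, IsUnaryGen S σ ∧ σ a = a' ∧ σ b = b' := by
  have hmem : Equiv.swap a a' b ∈ B := by
    rw [Equiv.swap_apply_def]
    split_ifs <;> assumption
  have hne : a' ≠ Equiv.swap a a' b := by
    intro h
    rw [← Equiv.swap_apply_left a a'] at h
    exact hab ((Equiv.swap a a').injective (by simpa using h))
  refine ⟨Equiv.swap (Equiv.swap a a' b) b' * Equiv.swap a a',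
    (hB _ hmem _ hb').mul (hB _ ha _ ha'), ?_, ?_⟩
  · simp [Equiv.swap_apply_of_ne_of_ne hne hab']
  · simp

theorem IsGen.swap_map [Finite A] [Finite κ] [DecidableEq (κ → A)] {u v : κ → A}
    (h : IsGen S (Equiv.swap u v))
    {σ : κ → Equiv.Perm A} (hσ : ∀ k, IsUnaryGen S (σ k)) :
    IsGen S (Equiv.swap (fun k => σ k (u k)) (fun k => σ k (v k))) := by
  have := ((IsGen.piCongrRight hσ).mul h).mul (IsGen.piCongrRight hσ).inv
  rw [← Equiv.swap_apply_apply] at this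
  exact this

theorem IsGen.swap_relabel [DecidableEq (κ → A)] [DecidableEq (κ' → A)] {u v : κ → A}
    (h : IsGen S (Equiv.swap u v)) (e : κ ≃ κ') :
    IsGen S (Equiv.swap (u ∘ e.symm) (v ∘ e.symm)) := by
  have : _root_.relabel e (Equiv.swap u v) = Equiv.swap (u ∘ e.symm) (v ∘ e.symm) := by
    apply Equiv.ext
    intro x
    have hx : ∀ w : κ → A, x ∘ e = w ↔ x = w ∘ e.symm := fun w => by
      rw [Equiv.eq_comp_symm]
    simp only [relabel_apply, Equiv.swap_apply_def, hx]
    split_ifs <;> simp [Function.comp_assoc]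
  exact this ▸ h.relabel e

variable [DecidableEq A] [Fintype κ] [DecidableEq κ] [Fintype κ'] [DecidableEq κ']

/-- All transpositions of two strings over `B` differing in at most one wire are generated. -/
def BlockSwaps (S : Set (Gate A)) (B : Finset A) (κ : Type) [Fintype κ]
    [DecidableEq κ] : Prop :=
  ∀ u : κ → A, (∀ k, u k ∈ B) → ∀ i, ∀ y ∈ B, IsGen S (Equiv.swap u (Function.update u i y))

theorem BlockSwaps.of_equiv (h : BlockSwaps S B κ) (e : κ ≃ κ') : BlockSwaps S B κ' := by
  intro u hu i y hy
  have := (h (u ∘ e) (fun k => hu _) (e.symm i) y hy).swap_relabel e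
  rw [Function.comp_assoc, e.self_comp_symm, Function.comp_id] at this
  convert this using 2
  funext k
  simp [Function.update_apply]

theorem BlockSwaps.of_single [Finite A]
    (hB : ∀ a ∈ B, ∀ b ∈ B, IsUnaryGen S (Equiv.swap a b))
    {u : κ → A} (hu : ∀ k, u k ∈ B) {i : κ} {y : A} (hy : y ∈ B) (hne : u i ≠ y)
    (h : IsGen S (Equiv.swap u (Function.update u i y))) : BlockSwaps S B κ := by
  intro u' hu' i' y' hy'
  rcases eq_or_ne (u' i') y' with rfl | hne'
  · rw [Function.update_eq_self, Equiv.swap_self]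
    exact IsGen.one
  set e := Equiv.swap i i' with he
  have h' := h.swap_relabel e
  obtain ⟨τ, hτ, hτ1, hτ2⟩ := exists_isUnaryGen_pair hB (hu i) hy (hu' i') hy' hne hne'
  have := h'.swap_map (σ := fun k => if k = i' then τ else Equiv.swap (u (e.symm k)) (u' k))
    fun k => by
      split_ifs
      exacts [hτ, hB _ (hu _) _ (hu' _)]
  convert this using 2
  · funext k
    by_cases hk : k = i'
    · subst hk
      simp [he, hτ1]
    · simp [hk]
  · funext k
    by_cases hk : k = i'
    · subst hk
      simp [he, hτ2]
    · have : e.symm k ≠ i := by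
        rw [Ne, Equiv.symm_apply_eq]
        simpa [he] using hk
      simp [hk, this]

theorem BlockSwaps.fin [Finite A] {a b : A} (ha : a ∈ B) (hb : b ∈ B) (hab : a ≠ b)
    (h1 : BlockSwaps S B (Fin 1)) (h2 : BlockSwaps S B (Fin 2)) (h3 : BlockSwaps S B (Fin 3)) :
    ∀ n, BlockSwaps S B (Fin n)
  | 0 => fun _ _ i => i.elim0
  | 1 => h1
  | 2 => h2
  | 3 => h3
  | n + 4 => by
    intro u hu i y hy
    obtain ⟨j₁, hj₁, j₂, hj₂, hj⟩ := (Finset.univ.erase i).one_lt_card.1 (by simp)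
    simp only [Finset.mem_erase, Finset.mem_univ, and_true] at hj₁ hj₂
    have ih : BlockSwaps S B {k : Fin (n + 4) // k ≠ j₁} :=
      (BlockSwaps.fin ha hb hab h1 h2 h3 (n + 3)).of_equiv (finSuccAboveEquiv j₁)
    let f : {k : Fin (n + 4) // k ≠ j₁} → Option (Fin (n + 4)) :=
      fun k => if (k : Fin (n + 4)) = j₂ then none else some k
    have hf : f.Injective := by
      intro k l hkl
      simp only [f] at hkl
      split_ifs at hkl with h h' <;> simp_all [Subtype.ext_iff]
    have hs : Function.Injective (some : Fin (n + 4) → _) := Option.some_injective _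
    have hg : Function.Injective (![some j₁, some j₂, none] : Fin 3 → Option (Fin (n + 4))) := by
      intro k l
      fin_cases k <;> fin_cases l <;> simp [hj, hj.symm]
    let u' : {k : Fin (n + 4) // k ≠ j₁} → A := fun k => if (k : Fin (n + 4)) = j₂ then a else u k
    have hu' : ∀ k, u' k ∈ B := fun k => by
      simp only [u']
      split_ifs
      exacts [ha, hu _]
    have hK : IsGen S (Equiv.swap ![u j₁, u j₂, b] ![u j₁, u j₂, a]) := by
      have := h3 ![u j₁, u j₂, b] (fun k => by fin_cases k <;> simp [hu, hb]) 2 a ha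
      convert this using 2
      funext k
      fin_cases k <;> rfl
    refine IsGen.ancilla ((hK.actOn hg).mul (((ih u' hu' ⟨i, hj₁.symm⟩ y hy).actOn hf).mul
      (hK.actOn hg))) hs (fun _ => b) fun x => ?_
    have hsome : ∀ w : Fin (n + 4) → A,
        Function.extend some w (fun _ => b) = fun o => o.elim b w := fun w => by
      funext o
      cases o with
      | none => exact Function.extend_apply' _ _ _ (by simp)
      | some k => exact hs.extend_apply _ _ k
    have hK' : ∀ (z : A) (w : Fin (n + 4) → A),
        actOn _ hg (Equiv.swap ![u j₁, u j₂, b] ![u j₁, u j₂, a]) (fun o => o.elim z w) =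
          fun o => o.elim (if w j₁ = u j₁ ∧ w j₂ = u j₂ then Equiv.swap b a z else z) w := by
      intro z w
      rw [actOn_three, swap_three_apply]
      funext o
      split_ifs <;> cases o <;> simp [Function.update_apply] <;> grind
    rw [hsome, hsome, Equiv.Perm.mul_apply, Equiv.Perm.mul_apply, hK']
    set v := Function.update u i y with hv
    have hvj₁ : v j₁ = u j₁ := Function.update_of_ne hj₁ _ _
    have hvj₂ : v j₂ = u j₂ := Function.update_of_ne hj₂ _ _
    let r : (Fin (n + 4) → A) → {k : Fin (n + 4) // k ≠ j₁} → A :=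
      fun w k => if (k : Fin (n + 4)) = j₂ then a else w k
    have hru : u' = r u := rfl
    have hrv : Function.update u' ⟨i, hj₁.symm⟩ y = r v := by
      funext k
      by_cases hk : (k : Fin (n + 4)) = i
      · have hk' : k = ⟨i, hj₁.symm⟩ := Subtype.ext hk
        simp [hk', r, hv, hj₂.symm]
      · have hk' : k ≠ ⟨i, hj₁.symm⟩ := fun h => hk (congrArg Subtype.val h)
        simp [hk, hk', r, hv, u']
    have hinj : ∀ w, w j₁ = u j₁ → w j₂ = u j₂ → x j₁ = u j₁ → x j₂ = u j₂ → r x = r w →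
        x = w := by
      intro w hw₁ hw₂ hx₁ hx₂ h
      funext k
      by_cases hk₁ : k = j₁
      · rw [hk₁, hx₁, hw₁]
      by_cases hk₂ : k = j₂
      · rw [hk₂, hx₂, hw₂]
      simpa [r, hk₂] using congrFun h ⟨k, hk₁⟩
    rw [hrv, hru]
    by_cases hx : x j₁ = u j₁ ∧ x j₂ = u j₂
    · have hcomp : (fun o : Option (Fin (n + 4)) => o.elim a x) ∘ f = r x := by
        funext k
        by_cases hk : (k : Fin (n + 4)) = j₂ <;> simp [f, r, hk]
      have hswap : Equiv.swap (r u) (r v) (r x) = r (Equiv.swap u v x) := by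
        by_cases hxu : x = u
        · rw [hxu, Equiv.swap_apply_left, Equiv.swap_apply_left]
        by_cases hxv : x = v
        · rw [hxv, Equiv.swap_apply_right, Equiv.swap_apply_right]
        rw [Equiv.swap_apply_of_ne_of_ne hxu hxv, Equiv.swap_apply_of_ne_of_ne]
        · exact fun h => hxu (hinj u rfl rfl hx.1 hx.2 h)
        · exact fun h => hxv (hinj v hvj₁ hvj₂ hx.1 hx.2 h)
      have hagree : Equiv.swap u v x j₁ = u j₁ ∧ Equiv.swap u v x j₂ = u j₂ := by
        rw [Equiv.swap_apply_def]
        split_ifs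
        exacts [⟨hvj₁, hvj₂⟩, ⟨rfl, rfl⟩, hx]
      have hmid : actOn f hf (Equiv.swap (r u) (r v)) (fun o => o.elim a x) =
          fun o => o.elim a (Equiv.swap u v x) := by
        rw [actOn_apply, hcomp, hswap]
        funext o
        by_cases ho : ∃ k, f k = o
        · obtain ⟨k, rfl⟩ := ho
          rw [hf.extend_apply]
          by_cases hk : (k : Fin (n + 4)) = j₂ <;> simp [f, r, hk]
        · rw [Function.extend_apply' _ _ _ ho]
          cases o with
          | none => rfl
          | some k =>
            by_cases hk₁ : k = j₁
            · simp [hk₁, hx, hagree]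
            by_cases hk₂ : k = j₂
            · simp [hk₂, hx, hagree]
            exact absurd ⟨⟨k, hk₁⟩, by simp [f, hk₂]⟩ ho
      rw [if_pos hx, Equiv.swap_apply_left, hmid, hK', if_pos hagree, Equiv.swap_apply_right]
    · have hcomp : ∀ w, (fun o : Option (Fin (n + 4)) => o.elim b x) ∘ f ≠ r w := fun w h => by
        have := congrFun h ⟨j₂, hj.symm⟩
        simp only [f, r, Function.comp_apply, if_true, Option.elim_none] at this
        exact hab this.symm
      rw [if_neg hx, actOn_of_fixed hf (Equiv.swap_apply_of_ne_of_ne (hcomp u) (hcomp v)), hK',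
        if_neg hx, Equiv.swap_apply_of_ne_of_ne]
      · exact fun h => hx (by rw [h]; exact ⟨rfl, rfl⟩)
      · exact fun h => hx (by rw [h]; exact ⟨hvj₁, hvj₂⟩)

/-- Transpositions along single wires generate every gate supported on strings over `B`. -/
theorem BlockSwaps.isGen [Finite A] (h : BlockSwaps S B κ) {F : Equiv.Perm (κ → A)}
    (hF : ∀ x : κ → A, (∃ k, x k ∉ B) → F x = x) : IsGen S F := by
  have hswap : ∀ u v : κ → A, (∀ k, u k ∈ B) → (∀ k, v k ∈ B) →
      Equiv.swap u v ∈ genGroup S κ := by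
    intro u v hu hv
    suffices H : ∀ s : Finset κ, Equiv.swap u (s.piecewise v u) ∈ genGroup S κ by
      simpa using H Finset.univ
    intro s
    induction s using Finset.induction_on with
    | empty =>
      rw [Finset.piecewise_empty, Equiv.swap_self]
      exact one_mem _
    | insert k s _ ih =>
      rw [Finset.piecewise_insert]
      refine SubmonoidClass.swap_mem_trans _ ih (h _ (fun j => ?_) _ _ (hv k))
      by_cases hj : j ∈ s <;> simp [hj, hu, hv]
  have hsub : ∀ f : Equiv.Perm {x : κ → A // ∀ k, x k ∈ B},
      Equiv.Perm.ofSubtype f ∈ genGroup S κ := by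
    intro f
    induction f using Equiv.Perm.swap_induction_on with
    | one => rw [map_one]; exact one_mem _
    | swap_mul f x y _ ih =>
      rw [map_mul, Equiv.Perm.ofSubtype_swap_eq]
      exact mul_mem (hswap _ _ x.2 y.2) ih
  have hsupp : ∀ x, F x ≠ x → ∀ k, x k ∈ B := fun x hx => by
    by_contra! hk
    exact hx (hF x hk)
  have hiff : ∀ x, (∀ k, F x k ∈ B) ↔ ∀ k, x k ∈ B := fun x => by
    by_cases hx : F x = x
    · rw [hx]
    · exact iff_of_true (hsupp _ fun h => hx (F.injective h)) (hsupp _ hx)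
  have := hsub (F.subtypePerm hiff)
  rwa [Equiv.Perm.ofSubtype_subtypePerm hiff hsupp] at this

end Blocks

theorem controlled_swapGate {A : Type*} [DecidableEq A] (o d c : A) :
    (controlled ![o] (swapGate d c) : Equiv.Perm (Fin 3 → A)) =
      Equiv.swap ![o, d, c] ![o, c, d] := by
  apply Equiv.ext
  intro x
  obtain ⟨p, q, r, rfl⟩ := eq_vec_three x
  have hvec : ∀ p q r : A, (splitEquiv A 1 2).symm (![p], ![q, r]) = ![p, q, r] := by
    intro p q r
    rw [Equiv.symm_apply_eq, splitEquiv_apply]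
    refine Prod.ext ?_ ?_ <;> funext j <;> fin_cases j <;> rfl
  rw [← hvec p q r]
  simp only [controlled, Equiv.trans_apply, Equiv.apply_symm_apply]
  rw [hvec, swap_exchange_apply, Equiv.prodCongrRight_apply]
  simp only [swapGate, tau, Matrix.vecCons_inj, and_true]
  by_cases hp : p = o
  · simp only [hp, if_true, true_and, Equiv.swap_apply_def, Matrix.vecCons_inj, and_true]
    split_ifs <;> simp only [hvec] <;> grind
  · simp [hp, hvec]

/-- The exchange gate `1-SWAP` between two blocks, with all letters moved within their blocks. -/
theorem IsGen.exchange_of_blocks {A ι : Type*} [Finite A] [DecidableEq A] {S : Set (Gate A)}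
    {B : ι → Finset A} (hdisj : ∀ i j, i ≠ j → Disjoint (B i) (B j))
    (hB : ∀ i, ∀ a ∈ B i, ∀ b ∈ B i, IsUnaryGen S (Equiv.swap a b)) {i j h : ι} (hij : i ≠ j)
    {o o' d d' c c' : A} (ho : o ∈ B h) (ho' : o' ∈ B h) (hd : d ∈ B i) (hd' : d' ∈ B i)
    (hc : c ∈ B j) (hc' : c' ∈ B j) (H : IsGen S (Equiv.swap ![o, d, c] ![o, c, d])) :
    IsGen S (Equiv.swap ![o', d', c'] ![o', c', d']) := by
  have hne : ∀ {s t}, s ∈ B i → t ∈ B j → s ≠ t := fun hs ht => by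
    rintro rfl
    exact Finset.disjoint_left.1 (hdisj i j hij) hs ht
  have hσ : IsUnaryGen S (Equiv.swap d d' * Equiv.swap c c') :=
    (hB i _ hd _ hd').mul (hB j _ hc _ hc')
  have hσd : (Equiv.swap d d' * Equiv.swap c c') d = d' := by
    rw [Equiv.Perm.mul_apply, Equiv.swap_apply_of_ne_of_ne (hne hd hc) (hne hd hc'),
      Equiv.swap_apply_left]
  have hσc : (Equiv.swap d d' * Equiv.swap c c') c = c' := by
    rw [Equiv.Perm.mul_apply, Equiv.swap_apply_left,
      Equiv.swap_apply_of_ne_of_ne (hne hd hc').symm (hne hd' hc').symm]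
  have := H.swap_map (σ := ![Equiv.swap o o', Equiv.swap d d' * Equiv.swap c c',
    Equiv.swap d d' * Equiv.swap c c']) fun k => by
      fin_cases k
      exacts [hB h _ ho _ ho', hσ, hσ]
  convert this using 2 <;> funext k <;> fin_cases k <;> simp [hσd, hσc, -Equiv.Perm.coe_mul]

/-- Here `λ` is a partition of `A = {1,…,k}` (`k ≥ 3`) given by disjoint nonempty blocks
`B i` covering `A`, and `S` is the generating set consisting of (1) `τ_{a,b}` for all
`a ≠ b` in a common block, (2) `τ_{aa,ab}` for one chosen pair `a = ca i ≠ cb i = b` in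
each block of size `> 1`, and (3) `1-SWAP_{a,b}` for one chosen pair `a = da i j ∈ B i`,
`b = db i j ∈ B j` for each `i < j`.
Then for every block index `i`, `S` generates every reversible gate that fixes all
inputs containing at least one symbol outside `B i`. -/
theorem generates_gates_supported_on_block (k l : ℕ) (hk : 3 ≤ k)
    (B : Fin l → Finset (Fin k))
    (hne : ∀ i, (B i).Nonempty)
    (hdisj : ∀ i j, i ≠ j → Disjoint (B i) (B j))
    (hcover : ∀ x : Fin k, ∃ i, x ∈ B i)
    (ca cb : Fin l → Fin k)
    (hc : ∀ i, 1 < (B i).card → ca i ∈ B i ∧ cb i ∈ B i ∧ ca i ≠ cb i)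
    (da db : Fin l → Fin l → Fin k)
    (hd : ∀ i j, i < j → da i j ∈ B i ∧ db i j ∈ B j)
    (i : Fin l) (n : ℕ) (F : GateFun (Fin k) n)
    (hF : ∀ x : Fin n → Fin k, (∃ j, x j ∉ B i) → F x = x) :
    Generates ({g : Gate (Fin k) | ∃ (i : Fin l) (a b : Fin k),
        a ∈ B i ∧ b ∈ B i ∧ a ≠ b ∧ g = ⟨1, tau ![a] ![b]⟩} ∪
      {g : Gate (Fin k) | ∃ i : Fin l, 1 < (B i).card ∧
        g = ⟨2, tau ![ca i, ca i] ![ca i, cb i]⟩} ∪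
      {g : Gate (Fin k) | ∃ i j : Fin l, i < j ∧
        g = ⟨1 + 2, controlled ![(⟨0, by omega⟩ : Fin k)]
          (swapGate (da i j) (db i j))⟩}) ⟨n, F⟩ := by
  generalize hS : ({g : Gate (Fin k) | ∃ (i : Fin l) (a b : Fin k),
        a ∈ B i ∧ b ∈ B i ∧ a ≠ b ∧ g = ⟨1, tau ![a] ![b]⟩} ∪
      {g : Gate (Fin k) | ∃ i : Fin l, 1 < (B i).card ∧
        g = ⟨2, tau ![ca i, ca i] ![ca i, cb i]⟩} ∪
      {g : Gate (Fin k) | ∃ i j : Fin l, i < j ∧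
        g = ⟨1 + 2, controlled ![(⟨0, by omega⟩ : Fin k)]
          (swapGate (da i j) (db i j))⟩} : Set (Gate (Fin k))) = S
  have hunary : ∀ i, ∀ a ∈ B i, ∀ b ∈ B i, IsUnaryGen S (Equiv.swap a b) := by
    intro i a ha b hb
    rcases eq_or_ne a b with rfl | hab
    · rw [Equiv.swap_self]
      exact IsGen.one
    · exact isUnaryGen_swap (.mem (hS ▸ .inl (.inl ⟨i, a, b, ha, hb, hab, rfl⟩)))
  have hcnot : 1 < (B i).card → IsGen S (Equiv.swap ![ca i, ca i] ![ca i, cb i]) := fun hi =>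
    Generates.isGen (.mem (hS ▸ .inl (.inr ⟨i, hi, rfl⟩)))
  have hexch : ∀ i j, i < j →
      IsGen S (Equiv.swap ![⟨0, by omega⟩, da i j, db i j] ![⟨0, by omega⟩, db i j, da i j]) :=
    fun i j hij => by
      rw [← controlled_swapGate]
      exact Generates.isGen (.mem (hS ▸ .inr ⟨i, j, hij, rfl⟩))
  have hnot : ∀ {a b}, a ∈ B i → b ∈ B i → a ≠ b → IsGen S (Equiv.swap ![a] ![b]) :=
    fun {a b} ha hb hab => Generates.isGen (.mem (hS ▸ .inl (.inl ⟨i, a, b, ha, hb, hab, rfl⟩)))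
  clear hS
  generalize (⟨0, by omega⟩ : Fin k) = o at hexch
  have hexch' : ∀ {h j : Fin l} {o' d c : Fin k}, i ≠ j → o ∈ B h → o' ∈ B h → d ∈ B i →
      c ∈ B j → IsGen S (Equiv.swap ![o', d, c] ![o', c, d]) := by
    intro h j o' d c hij ho ho' hdi hcj
    rcases lt_or_gt_of_ne hij with hlt | hgt
    · exact (hexch i j hlt).exchange_of_blocks hdisj hunary hij ho ho' (hd i j hlt).1 hdi
        (hd i j hlt).2 hcj
    · have := (hexch j i hgt).exchange_of_blocks hdisj hunary hij.symm ho ho' (hd j i hgt).1 hcj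
        (hd j i hgt).2 hdi
      rwa [Equiv.swap_comm] at this
  refine IsGen.generates (BlockSwaps.isGen (B := B i) ?_ hF)
  rcases Nat.lt_or_ge 1 (B i).card with hcard | hcard
  swap
  · intro u hu j y hy
    rw [Finset.card_le_one.1 hcard y hy (u j) (hu j), Function.update_eq_self, Equiv.swap_self]
    exact IsGen.one
  obtain ⟨ha, hb, hab⟩ := hc i hcard
  specialize hcnot hcard
  generalize ca i = a at ha hab hcnot
  generalize cb i = b at hb hab hcnot
  have h1 : BlockSwaps S (B i) (Fin 1) := by
    refine .of_single (hunary i) (u := ![a]) (fun j => ?_) (i := 0) hb hab ?_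
    · fin_cases j; exact ha
    · convert hnot ha hb hab using 2
      ext j
      fin_cases j; rfl
  have h2 : BlockSwaps S (B i) (Fin 2) := by
    refine .of_single (hunary i) (u := ![a, a]) (fun j => ?_) (i := 1) hb hab ?_
    · fin_cases j <;> exact ha
    · convert hcnot using 2
      ext j
      fin_cases j <;> rfl
  have h2' : ∀ c ∈ B i, ∀ u ∈ B i, ∀ v ∈ B i, IsGen S (Equiv.swap ![c, u] ![c, v]) := by
    intro c hc u hu v hv
    convert h2 ![c, u] (fun j => ?_) 1 v hv using 2
    · ext j
      fin_cases j <;> rfl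
    · fin_cases j
      exacts [hc, hu]
  have h3' : IsGen S (Equiv.swap ![a, a, a] ![a, a, b]) := by
    by_cases hthree : ∃ c ∈ B i, a ≠ c ∧ b ≠ c
    · obtain ⟨c, hcB, hac, hbc⟩ := hthree
      exact isGen_swap_three_of_three_letters hab hac hbc hcnot (h2' _ ha _ hb _ hcB)
        (h2' _ hcB _ ha _ hb)
    obtain ⟨c, hca, hcb⟩ : ∃ c : Fin k, c ≠ a ∧ c ≠ b := by
      obtain ⟨c, hc⟩ := Finset.exists_mem_notMem_of_card_lt_card
        (s := {a, b}) (t := (Finset.univ : Finset (Fin k)))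
        (Finset.card_le_two.trans_lt (by rw [Finset.card_univ, Fintype.card_fin]; omega))
      exact ⟨c, by simpa using hc⟩
    have hcB : c ∉ B i := fun h => hthree ⟨c, h, hca.symm, hcb.symm⟩
    obtain ⟨h, ho⟩ := hcover o
    by_cases hhi : i = h
    · subst hhi
      obtain ⟨j, hj⟩ := hcover c
      have hij : i ≠ j := fun h => hcB (h ▸ hj)
      exact isGen_swap_three_of_exchange hca.symm hcnot (hexch' hij ho ha ha hj)
    · have hao : a ≠ o := fun e => Finset.disjoint_left.1 (hdisj i h hhi) ha (e ▸ ho)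
      exact isGen_swap_three_of_exchange hao hcnot
        (isGen_exchange_control hao (hexch' hhi ho ho ha ho))
  have h3 : BlockSwaps S (B i) (Fin 3) := by
    refine .of_single (hunary i) (u := ![a, a, a]) (fun j => ?_) (i := 2) hb hab ?_
    · fin_cases j <;> exact ha
    · convert h3' using 2
      ext j
      fin_cases j <;> rfl
  exact BlockSwaps.fin ha hb hab h1 h2 h3 n
end
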